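/- arXiv:2502.03064 — 12 statements merged into one kernel-verified Lean document; each statement's English description precedes it below -/
import Mathlib

section
/- Let I₁ ⊆ ℝ be an open interval, let f₁ : I₁ → ℝ be smooth and nowhere zero, and let f : I₁ → ℝ be smooth and nowhere zero. Set h := f'/f and h₁ := f₁'/f₁. Suppose h'(x) = h(x)·(h(x) − h₁(x)) for all x ∈ I₁ and h(x₀) ≠ 0 for some x₀ ∈ I₁. Then h(x) ≠ 0 for every x ∈ I₁, and for any antiderivative F of 1/f₁ on I₁ there exist k ∈ ℝ \ {0} and c ∈ ℝ with c ∉ F(I₁) such that f(x) = k/(F(x) − c) for all x ∈ I₁. -/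
/-- On an open order-connected subset of `ℝ`, a function with zero derivative is constant. -/
theorem eq_of_hasDerivAt_zero_of_ordConnected {s : Set ℝ} (hso : IsOpen s) (hs : s.OrdConnected)
    {u : ℝ → ℝ} (hu : ∀ x ∈ s, HasDerivAt u 0 x) {x y : ℝ} (hx : x ∈ s) (hy : y ∈ s) :
    u x = u y :=
  hso.is_const_of_deriv_eq_zero hs.isPreconnected
    (fun z hz => (hu z hz).differentiableAt.differentiableWithinAt)
    (fun z hz => (hu z hz).deriv) hx hy

/-- Key ODE lemma: if `h = f'/f` satisfies `h' = h (h - h₁)` on an open interval `I₁` and is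
nonzero at one point, then `h` is nowhere zero on `I₁` and, for any antiderivative `F` of
`1/f₁` on `I₁`, we have `f = k / (F - c)` for some `k ≠ 0` and `c ∉ F(I₁)`. -/
theorem stmt_0 (I₁ : Set ℝ) (hI₁open : IsOpen I₁) (hI₁conn : I₁.OrdConnected)
    (hI₁ne : I₁.Nonempty)
    (f₁ f : ℝ → ℝ)
    (hf₁smooth : ContDiffOn ℝ (⊤ : ℕ∞) f₁ I₁) (hf₁ne : ∀ x ∈ I₁, f₁ x ≠ 0)
    (hfsmooth : ContDiffOn ℝ (⊤ : ℕ∞) f I₁) (hfne : ∀ x ∈ I₁, f x ≠ 0)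
    (h h₁ : ℝ → ℝ)
    (hh : h = fun x => deriv f x / f x)
    (hh₁ : h₁ = fun x => deriv f₁ x / f₁ x)
    (hode : ∀ x ∈ I₁, deriv h x = h x * (h x - h₁ x))
    (hx₀ : ∃ x₀ ∈ I₁, h x₀ ≠ 0) :
    (∀ x ∈ I₁, h x ≠ 0) ∧
      ∀ F : ℝ → ℝ, (∀ x ∈ I₁, HasDerivAt F (1 / f₁ x) x) →
        ∃ k : ℝ, k ≠ 0 ∧ ∃ c : ℝ, (∀ x ∈ I₁, F x ≠ c) ∧
          ∀ x ∈ I₁, f x = k / (F x - c) := by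
  obtain ⟨x₀, hx₀, hhx₀⟩ := hx₀
  have hf' : ∀ x ∈ I₁, HasDerivAt f (h x * f x) x := fun x hx => by
    have hd := ((hfsmooth.differentiableOn (by simp)).differentiableAt
      (hI₁open.mem_nhds hx)).hasDerivAt
    rwa [show h x * f x = deriv f x by rw [hh]; exact div_mul_cancel₀ _ (hfne x hx)]
  have hf₁' : ∀ x ∈ I₁, HasDerivAt f₁ (h₁ x * f₁ x) x := fun x hx => by
    have hd := ((hf₁smooth.differentiableOn (by simp)).differentiableAt
      (hI₁open.mem_nhds hx)).hasDerivAt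
    rwa [show h₁ x * f₁ x = deriv f₁ x by rw [hh₁]; exact div_mul_cancel₀ _ (hf₁ne x hx)]
  have hh' : ∀ x ∈ I₁, HasDerivAt h (h x * (h x - h₁ x)) x := fun x hx => by
    have hd : DifferentiableAt ℝ (deriv f) x :=
      ((hfsmooth.deriv_of_isOpen (m := 1) hI₁open (WithTop.coe_le_coe.2 le_top)).differentiableOn
        (by simp)).differentiableAt (hI₁open.mem_nhds hx)
    rw [← hode x hx]
    refine DifferentiableAt.hasDerivAt ?_
    rw [hh]
    exact hd.div (hf' x hx).differentiableAt (hfne x hx)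
  -- `h * f₁ / f` is a first integral of the equation.
  obtain ⟨A, hA⟩ : ∃ A, A = h x₀ * f₁ x₀ / f x₀ := ⟨_, rfl⟩
  have hA0 : A ≠ 0 := by
    rw [hA]
    exact div_ne_zero (mul_ne_zero hhx₀ (hf₁ne x₀ hx₀)) (hfne x₀ hx₀)
  have hint : ∀ x ∈ I₁, h x * f₁ x / f x = A := fun x hx => by
    rw [hA]
    refine eq_of_hasDerivAt_zero_of_ordConnected (u := fun x => h x * f₁ x / f x)
      hI₁open hI₁conn (fun y hy => ?_) hx hx₀
    refine (((hh' y hy).mul (hf₁' y hy)).div (hf' y hy) (hfne y hy)).congr_deriv ?_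
    rw [div_eq_zero_iff]
    left
    simp only [Pi.mul_apply]
    ring
  refine ⟨fun x hx h0 => hA0 (by rw [← hint x hx, h0]; simp), fun F hF => ?_⟩
  obtain ⟨C, hC⟩ : ∃ C, C = (f x₀)⁻¹ + A * F x₀ := ⟨_, rfl⟩
  have hCint : ∀ x ∈ I₁, (f x)⁻¹ + A * F x = C := fun x hx => by
    rw [hC]
    refine eq_of_hasDerivAt_zero_of_ordConnected (u := fun x => (f x)⁻¹ + A * F x)
      hI₁open hI₁conn (fun y hy => ?_) hx hx₀
    refine (((hf' y hy).inv (hfne y hy)).add ((hF y hy).const_mul A)).congr_deriv ?_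
    rw [← hint y hy]
    have := hfne y hy
    have := hf₁ne y hy
    field_simp
    ring
  have hsub : ∀ x ∈ I₁, F x - C / A = -A⁻¹ * (f x)⁻¹ := fun x hx => by
    rw [← hCint x hx]
    field_simp
    ring
  have hk : -A⁻¹ ≠ 0 := neg_ne_zero.2 (inv_ne_zero hA0)
  refine ⟨-A⁻¹, hk, C / A, fun x hx => ?_, fun x hx => ?_⟩
  · rw [← sub_ne_zero, hsub x hx]
    exact mul_ne_zero hk (inv_ne_zero (hfne x hx))
  · rw [hsub x hx, ← div_eq_mul_inv, div_div_cancel₀ hk]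
end

section
/- Let I₁ ⊆ ℝ be an open interval and let f₁, f₂, f₃ : I₁ → ℝ be smooth nowhere-zero functions; set hᵢ := fᵢ'/fᵢ for i ∈ {1,2,3}. Then the system { h₂(x)h₃(x) = 0, h₂'(x) = h₂(x)(h₂(x) − h₁(x)), h₃'(x) = h₃(x)(h₃(x) − h₁(x)) for all x ∈ I₁ } holds if and only if one of the following holds, where F is any fixed antiderivative of 1/f₁ on I₁: (1) f₂ and f₃ are both constant; (2) f₂ is constant and f₃ = k₃/(F − c₃) for some k₃ ∈ ℝ \ {0} and c₃ ∈ ℝ \ F(I₁); (3) f₃ is constant and f₂ = k₂/(F − c₂) for some k₂ ∈ ℝ \ {0} and c₂ ∈ ℝ \ F(I₁). -/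
/-- If `f * (a F + b) = 1` with `F' = 1 / g`, then the logarithmic derivative of `f` is
`-a f / g`. -/
theorem logDeriv_eq_of_mul_affine_eq_one {s : Set ℝ} (hs : IsOpen s) {f g F : ℝ → ℝ}
    (hf : DifferentiableOn ℝ f s)
    (hF : ∀ x ∈ s, HasDerivAt F (1 / g x) x) {a b : ℝ}
    (h : ∀ x ∈ s, f x * (a * F x + b) = 1) {x : ℝ} (hx : x ∈ s) :
    deriv f x / f x = -a * f x / g x := by
  have hfx : HasDerivAt f (deriv f x) x := (hf.differentiableAt (hs.mem_nhds hx)).hasDerivAt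
  have hprod := hfx.mul (((hF x hx).const_mul a).add_const b)
  have hone : HasDerivAt (f * fun y => a * F y + b) 0 x :=
    (hasDerivAt_const x (1 : ℝ)).congr_of_eventuallyEq
      (Filter.eventually_of_mem (hs.mem_nhds hx) h)
  have key := hprod.unique hone
  have hx1 := h x hx
  have hf0 : f x ≠ 0 := left_ne_zero_of_mul_eq_one hx1
  rw [div_eq_iff hf0]
  linear_combination f x * key - deriv f x * hx1

/-- The second-order equation `h' = h (h - g' / g)` for `h = f' / f` says precisely that `1 / f`
is an affine function of an antiderivative of `1 / g`. -/
theorem logDeriv_ode_iff {s : Set ℝ} (hs : IsOpen s) (hconn : IsPreconnected s)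
    {f g F : ℝ → ℝ}
    (hf : ContDiffOn ℝ (⊤ : ℕ∞) f s) (hf0 : ∀ x ∈ s, f x ≠ 0)
    (hg : DifferentiableOn ℝ g s) (hg0 : ∀ x ∈ s, g x ≠ 0)
    (hF : ∀ x ∈ s, HasDerivAt F (1 / g x) x) :
    (∀ x ∈ s, deriv (fun y => deriv f y / f y) x =
        deriv f x / f x * (deriv f x / f x - deriv g x / g x)) ↔
      ∃ a b : ℝ, ∀ x ∈ s, f x * (a * F x + b) = 1 := by
  have hfd : DifferentiableOn ℝ f s := hf.differentiableOn (by simp)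
  have hf' : ∀ x ∈ s, HasDerivAt f (deriv f x) x := fun x hx =>
    (hfd.differentiableAt (hs.mem_nhds hx)).hasDerivAt
  have hg' : ∀ x ∈ s, HasDerivAt g (deriv g x) x := fun x hx =>
    (hg.differentiableAt (hs.mem_nhds hx)).hasDerivAt
  constructor
  · intro hode
    have hdf : DifferentiableOn ℝ (deriv f) s :=
      (hf.deriv_of_isOpen (m := (⊤ : ℕ∞)) hs (by simp)).differentiableOn (by simp)
    have hv : ∀ x ∈ s, HasDerivAt (fun y => g y * (deriv f y / f y) / f y) 0 x := by
      intro x hx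
      have hh : HasDerivAt (fun y => deriv f y / f y) _ x :=
        ((hdf.differentiableAt (hs.mem_nhds hx)).div (hf' x hx).differentiableAt
          (hf0 x hx)).hasDerivAt
      replace hh := hh.congr_deriv (hode x hx)
      refine (((hg' x hx).mul hh).div (hf' x hx) (hf0 x hx)).congr_deriv ?_
      have := hf0 x hx
      have := hg0 x hx
      simp only [Pi.mul_apply]
      field_simp
      ring
    obtain ⟨c, hc⟩ := hs.exists_is_const_of_deriv_eq_zero hconn
      (fun x hx => (hv x hx).differentiableAt.differentiableWithinAt)
      (fun x hx => (hv x hx).deriv)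
    have hw : ∀ x ∈ s, HasDerivAt (fun y => (f y)⁻¹ + c * F y) 0 x := by
      intro x hx
      refine (((hf' x hx).inv (hf0 x hx)).add ((hF x hx).const_mul c)).congr_deriv ?_
      rw [← hc x hx]
      have := hf0 x hx
      have := hg0 x hx
      field_simp
      ring
    obtain ⟨b, hb⟩ := hs.exists_is_const_of_deriv_eq_zero hconn
      (fun x hx => (hw x hx).differentiableAt.differentiableWithinAt)
      (fun x hx => (hw x hx).deriv)
    refine ⟨-c, b, fun x hx => ?_⟩
    rw [← hb x hx]
    have := hf0 x hx
    field_simp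
    ring
  · rintro ⟨a, b, hab⟩ x hx
    have heq : ∀ y ∈ s, deriv f y / f y = -a * f y / g y := fun y hy =>
      logDeriv_eq_of_mul_affine_eq_one hs hfd hF hab hy
    have hd : HasDerivAt (fun y => deriv f y / f y) _ x :=
      (((hf' x hx).const_mul (-a)).div (hg' x hx) (hg0 x hx)).congr_of_eventuallyEq
        (Filter.eventually_of_mem (hs.mem_nhds hx) heq)
    rw [hd.deriv]
    have hfx := hf0 x hx
    have hgx := hg0 x hx
    have e : deriv f x = f x * (-a * f x / g x) := by
      rw [← heq x hx]; field_simp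
    rw [e]
    field_simp
    ring

/-- If `f * (a F + b) = 1` with `a ≠ 0`, then `f = k / (F - c)` for some `k ≠ 0` and some `c`
that `F` does not attain. -/
theorem exists_eq_div_sub_of_mul_affine_eq_one {s : Set ℝ} {f F : ℝ → ℝ} {a b : ℝ} (ha : a ≠ 0)
    (h : ∀ x ∈ s, f x * (a * F x + b) = 1) :
    ∃ k : ℝ, k ≠ 0 ∧ ∃ c : ℝ, (∀ x ∈ s, F x ≠ c) ∧ ∀ x ∈ s, f x = k / (F x - c) := by
  have hne : ∀ x ∈ s, F x - -b / a ≠ 0 := by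
    intro x hx h0
    have : a * F x + b = 0 := by
      have hF : F x = -b / a := sub_eq_zero.mp h0
      rw [hF]; field_simp; ring
    simpa [this] using h x hx
  refine ⟨a⁻¹, inv_ne_zero ha, -b / a, fun x hx => sub_ne_zero.mp (hne x hx), fun x hx => ?_⟩
  rw [eq_div_iff (hne x hx)]
  have := h x hx
  field_simp
  linear_combination this

theorem exists_mul_affine_eq_one_of_eq_div_sub {s : Set ℝ} {f F : ℝ → ℝ} {k c : ℝ} (hk : k ≠ 0)
    (hc : ∀ x ∈ s, F x ≠ c) (h : ∀ x ∈ s, f x = k / (F x - c)) :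
    ∃ a b : ℝ, ∀ x ∈ s, f x * (a * F x + b) = 1 := by
  refine ⟨1 / k, -c / k, fun x hx => ?_⟩
  have := sub_ne_zero.mpr (hc x hx)
  rw [h x hx]
  field_simp
  ring

theorem exists_forall_eq_of_mul_eq_one {s : Set ℝ} {f F : ℝ → ℝ} {b : ℝ}
    (h : ∀ x ∈ s, f x * (0 * F x + b) = 1) : ∃ k : ℝ, ∀ x ∈ s, f x = k :=
  ⟨b⁻¹, fun x hx => eq_inv_of_mul_eq_one_left (by simpa using h x hx)⟩

theorem exists_mul_eq_one_of_forall_eq {s : Set ℝ} {f F : ℝ → ℝ} {k : ℝ}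
    (hf0 : ∀ x ∈ s, f x ≠ 0) (h : ∀ x ∈ s, f x = k) :
    ∃ a b : ℝ, ∀ x ∈ s, f x * (a * F x + b) = 1 := by
  refine ⟨0, k⁻¹, fun x hx => ?_⟩
  rw [← h x hx, zero_mul, zero_add, mul_inv_cancel₀ (hf0 x hx)]

theorem deriv_eq_zero_of_forall_eq {s : Set ℝ} (hs : IsOpen s) {f : ℝ → ℝ} {k : ℝ}
    (h : ∀ x ∈ s, f x = k) {x : ℝ} (hx : x ∈ s) : deriv f x = 0 :=
  ((hasDerivAt_const x k).congr_of_eventuallyEq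
    (Filter.eventually_of_mem (hs.mem_nhds hx) h)).deriv

/-- Theorem 2.1 of the paper, in analytic form: for smooth nowhere-zero `f₁, f₂, f₃` on the open
interval `I₁`, with `hᵢ = fᵢ'/fᵢ`, the flatness system `h₂h₃ = 0`, `h₂' = h₂(h₂ - h₁)`,
`h₃' = h₃(h₃ - h₁)` holds iff (1) `f₂, f₃` are constant, or (2) `f₂` constant and
`f₃ = k₃/(F - c₃)`, or (3) `f₃` constant and `f₂ = k₂/(F - c₂)`, where `F` is an antiderivative
of `1/f₁`. -/
theorem stmt_1 (I₁ : Set ℝ) (hI₁open : IsOpen I₁) (hI₁conn : I₁.OrdConnected)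
    (hI₁ne : I₁.Nonempty)
    (f₁ f₂ f₃ : ℝ → ℝ)
    (hf₁smooth : ContDiffOn ℝ (⊤ : ℕ∞) f₁ I₁) (hf₁ne : ∀ x ∈ I₁, f₁ x ≠ 0)
    (hf₂smooth : ContDiffOn ℝ (⊤ : ℕ∞) f₂ I₁) (hf₂ne : ∀ x ∈ I₁, f₂ x ≠ 0)
    (hf₃smooth : ContDiffOn ℝ (⊤ : ℕ∞) f₃ I₁) (hf₃ne : ∀ x ∈ I₁, f₃ x ≠ 0)
    (h₁ h₂ h₃ : ℝ → ℝ)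
    (hh₁ : h₁ = fun x => deriv f₁ x / f₁ x)
    (hh₂ : h₂ = fun x => deriv f₂ x / f₂ x)
    (hh₃ : h₃ = fun x => deriv f₃ x / f₃ x)
    (F : ℝ → ℝ) (hF : ∀ x ∈ I₁, HasDerivAt F (1 / f₁ x) x) :
    (∀ x ∈ I₁, h₂ x * h₃ x = 0 ∧
        deriv h₂ x = h₂ x * (h₂ x - h₁ x) ∧
        deriv h₃ x = h₃ x * (h₃ x - h₁ x)) ↔
      ((∃ k₂ : ℝ, ∀ x ∈ I₁, f₂ x = k₂) ∧ (∃ k₃ : ℝ, ∀ x ∈ I₁, f₃ x = k₃)) ∨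
      ((∃ k₂ : ℝ, ∀ x ∈ I₁, f₂ x = k₂) ∧
        ∃ k₃ : ℝ, k₃ ≠ 0 ∧ ∃ c₃ : ℝ, (∀ x ∈ I₁, F x ≠ c₃) ∧
          ∀ x ∈ I₁, f₃ x = k₃ / (F x - c₃)) ∨
      ((∃ k₃ : ℝ, ∀ x ∈ I₁, f₃ x = k₃) ∧
        ∃ k₂ : ℝ, k₂ ≠ 0 ∧ ∃ c₂ : ℝ, (∀ x ∈ I₁, F x ≠ c₂) ∧
          ∀ x ∈ I₁, f₂ x = k₂ / (F x - c₂)) := by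
  subst hh₁ hh₂ hh₃
  have hconn := hI₁conn.isPreconnected
  have hg := hf₁smooth.differentiableOn (by simp)
  have iff₂ := logDeriv_ode_iff hI₁open hconn hf₂smooth hf₂ne hg hf₁ne hF
  have iff₃ := logDeriv_ode_iff hI₁open hconn hf₃smooth hf₃ne hg hf₁ne hF
  constructor
  · intro h
    obtain ⟨a₂, b₂, h₂⟩ := iff₂.mp fun x hx => (h x hx).2.1
    obtain ⟨a₃, b₃, h₃⟩ := iff₃.mp fun x hx => (h x hx).2.2
    obtain ⟨x, hx⟩ := hI₁ne
    have hprod : deriv f₂ x / f₂ x * (deriv f₃ x / f₃ x) = 0 := (h x hx).1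
    rw [logDeriv_eq_of_mul_affine_eq_one hI₁open (hf₂smooth.differentiableOn (by simp)) hF h₂ hx,
      logDeriv_eq_of_mul_affine_eq_one hI₁open (hf₃smooth.differentiableOn (by simp)) hF h₃ hx]
      at hprod
    have ha : a₂ = 0 ∨ a₃ = 0 := by
      simpa [hf₁ne x hx, hf₂ne x hx, hf₃ne x hx] using hprod
    by_cases ha₂ : a₂ = 0
    · subst ha₂
      have const₂ := exists_forall_eq_of_mul_eq_one h₂
      by_cases ha₃ : a₃ = 0
      · subst ha₃
        exact Or.inl ⟨const₂, exists_forall_eq_of_mul_eq_one h₃⟩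
      · exact Or.inr (Or.inl ⟨const₂, exists_eq_div_sub_of_mul_affine_eq_one ha₃ h₃⟩)
    · obtain rfl := ha.resolve_left ha₂
      exact Or.inr (Or.inr ⟨exists_forall_eq_of_mul_eq_one h₃,
        exists_eq_div_sub_of_mul_affine_eq_one ha₂ h₂⟩)
  · rintro (⟨⟨k₂, hk₂⟩, k₃, hk₃⟩ | ⟨⟨k₂, hk₂⟩, k₃, hk₃, c, hc, hf⟩ |
      ⟨⟨k₃, hk₃⟩, k₂, hk₂, c, hc, hf⟩) x hx
    · exact ⟨by simp [deriv_eq_zero_of_forall_eq hI₁open hk₂ hx],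
        iff₂.mpr (exists_mul_eq_one_of_forall_eq hf₂ne hk₂) x hx,
        iff₃.mpr (exists_mul_eq_one_of_forall_eq hf₃ne hk₃) x hx⟩
    · exact ⟨by simp [deriv_eq_zero_of_forall_eq hI₁open hk₂ hx],
        iff₂.mpr (exists_mul_eq_one_of_forall_eq hf₂ne hk₂) x hx,
        iff₃.mpr (exists_mul_affine_eq_one_of_eq_div_sub hk₃ hc hf) x hx⟩
    · exact ⟨by simp [deriv_eq_zero_of_forall_eq hI₁open hk₃ hx],
        iff₂.mpr (exists_mul_affine_eq_one_of_eq_div_sub hk₂ hc hf) x hx,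
        iff₃.mpr (exists_mul_eq_one_of_forall_eq hf₃ne hk₃) x hx⟩
end

section
/- Let I₁ ⊆ ℝ be an open interval, let c₀ ∈ ℝ \ {0}, and let f₁, f₂, f₃ : I₁ → ℝ be smooth nowhere-zero functions with f₁'/f₁ = c₀ identically on I₁ (so f₁(x) = c₁e^{c₀x} for some c₁ ≠ 0); set hᵢ := fᵢ'/fᵢ. Then the system { h₂h₃ = 0, h₂' = h₂(h₂ − h₁), h₃' = h₃(h₃ − h₁) on I₁ } holds if and only if either f₂ and f₃ are both constant, or there is (i,j) ∈ {(2,3),(3,2)} such that fᵢ = kᵢ ∈ ℝ \ {0} is constant and fⱼ(x) = kⱼ/(e^{−c₀x} − cⱼ) for all x ∈ I₁, where kⱼ ∈ ℝ \ {0} and cⱼ ∈ ℝ satisfies cⱼ ≠ e^{−c₀x} for every x ∈ I₁. -/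
/-- On a preconnected open set, the logarithmic derivative of `f` solves `h' = h (h - c)` only if
`1 / f` is an affine function of `e^{-cx}`. -/
lemma exists_inv_eq_of_deriv_logDeriv {I : Set ℝ} (hI : IsOpen I) (hIc : IsPreconnected I)
    {c : ℝ} (hc : c ≠ 0) {f : ℝ → ℝ} (hf : ContDiffOn ℝ (⊤ : ℕ∞) f I) (hne : ∀ x ∈ I, f x ≠ 0)
    (h : ∀ x ∈ I, deriv (fun y => deriv f y / f y) x = deriv f x / f x * (deriv f x / f x - c)) :
    ∃ A B : ℝ, ∀ x ∈ I, (f x)⁻¹ = A * Real.exp (-c * x) + B := by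
  have hdf : ∀ x ∈ I, HasDerivAt f (deriv f x) x := fun x hx =>
    ((hf.differentiableOn (by simp)).differentiableAt (hI.mem_nhds hx)).hasDerivAt
  have hdh : ∀ x ∈ I, HasDerivAt (fun y => deriv f y / f y)
      (deriv f x / f x * (deriv f x / f x - c)) x := by
    intro x hx
    rw [← h x hx]
    have h1 : ContDiffOn ℝ 1 (deriv f) I := hf.deriv_of_isOpen hI (by norm_num; exact WithTop.coe_le_coe.2 le_top)
    exact (((h1.differentiableOn (by simp)).differentiableAt (hI.mem_nhds hx)).div
      (hdf x hx).differentiableAt (hne x hx)).hasDerivAt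
  have hexp : ∀ a x : ℝ, HasDerivAt (fun y => Real.exp (a * y)) (Real.exp (a * x) * a) x :=
    fun a x => by simpa using ((hasDerivAt_id x).const_mul a).exp
  have hP : ∀ x ∈ I, HasDerivAt (fun y => deriv f y / f y * (f y)⁻¹ * Real.exp (c * y)) 0 x := by
    intro x hx
    have hx0 := hne x hx
    refine (((hdh x hx).mul ((hdf x hx).inv hx0)).mul (hexp c x)).congr_deriv ?_
    simp only [Pi.mul_apply, Pi.inv_apply]
    field_simp
    ring
  obtain ⟨A, hA⟩ := hI.exists_is_const_of_deriv_eq_zero hIc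
    (fun x hx => (hP x hx).differentiableAt.differentiableWithinAt) (fun x hx => (hP x hx).deriv)
  have hQ : ∀ x ∈ I, HasDerivAt (fun y => (f y)⁻¹ - A / c * Real.exp (-c * y)) 0 x := by
    intro x hx
    have hx0 := hne x hx
    refine (((hdf x hx).inv hx0).sub ((hexp (-c) x).const_mul (A / c))).congr_deriv ?_
    rw [← hA x hx, neg_mul, Real.exp_neg]
    have := (Real.exp_pos (c * x)).ne'
    field_simp
    ring
  obtain ⟨B, hB⟩ := hI.exists_is_const_of_deriv_eq_zero hIc
    (fun x hx => (hQ x hx).differentiableAt.differentiableWithinAt) (fun x hx => (hQ x hx).deriv)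
  exact ⟨A / c, B, fun x hx => by linarith [hB x hx]⟩

lemma logDeriv_eq_of_inv_eq {I : Set ℝ} (hI : IsOpen I) {c A B : ℝ} {f : ℝ → ℝ}
    (hne : ∀ x ∈ I, f x ≠ 0) (h : ∀ x ∈ I, (f x)⁻¹ = A * Real.exp (-c * x) + B) :
    ∀ x ∈ I, HasDerivAt f (c * A * Real.exp (-c * x) * f x * f x) x ∧
      deriv f x / f x = c * A * Real.exp (-c * x) * f x := by
  intro x hx
  have hx0 := hne x hx
  have hg : HasDerivAt (fun y => A * Real.exp (-c * y) + B) (A * (Real.exp (-c * x) * -c)) x := by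
    simpa using ((((hasDerivAt_id x).const_mul (-c)).exp).const_mul A).add_const B
  have hfg : f =ᶠ[nhds x] (fun y => A * Real.exp (-c * y) + B)⁻¹ := by
    filter_upwards [hI.mem_nhds hx] with y hy
    rw [Pi.inv_apply, ← h y hy, inv_inv]
  have hd : HasDerivAt f (c * A * Real.exp (-c * x) * f x * f x) x := by
    refine ((hg.inv (by rw [← h x hx]; exact inv_ne_zero hx0)).congr_of_eventuallyEq
      hfg).congr_deriv ?_
    rw [← h x hx]
    field_simp
  refine ⟨hd, ?_⟩
  rw [hd.deriv]
  field_simp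

lemma deriv_logDeriv_of_inv_eq {I : Set ℝ} (hI : IsOpen I) {c A B : ℝ} {f : ℝ → ℝ}
    (hne : ∀ x ∈ I, f x ≠ 0) (h : ∀ x ∈ I, (f x)⁻¹ = A * Real.exp (-c * x) + B) :
    ∀ x ∈ I, deriv (fun y => deriv f y / f y) x = deriv f x / f x * (deriv f x / f x - c) := by
  intro x hx
  have hl := logDeriv_eq_of_inv_eq hI hne h
  have he : HasDerivAt (fun y => c * A * Real.exp (-c * y))
      (c * A * (Real.exp (-c * x) * -c)) x := by
    simpa using (((hasDerivAt_id x).const_mul (-c)).exp).const_mul (c * A)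
  have heq : (fun y => deriv f y / f y) =ᶠ[nhds x]
      ((fun y => c * A * Real.exp (-c * y)) * f) := by
    filter_upwards [hI.mem_nhds hx] with y hy
    exact (hl y hy).2
  rw [heq.deriv_eq, (he.mul (hl x hx).1).deriv, (hl x hx).2]
  ring

lemma inv_eq_of_eq_const {I : Set ℝ} {c k : ℝ} {f : ℝ → ℝ} (h : ∀ x ∈ I, f x = k) :
    ∀ x ∈ I, (f x)⁻¹ = 0 * Real.exp (-c * x) + k⁻¹ :=
  fun x hx => by rw [h x hx]; ring

lemma inv_eq_of_eq_div {I : Set ℝ} {c k a : ℝ} {f : ℝ → ℝ}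
    (h : ∀ x ∈ I, f x = k / (Real.exp (-c * x) - a)) :
    ∀ x ∈ I, (f x)⁻¹ = k⁻¹ * Real.exp (-c * x) + -(a / k) :=
  fun x hx => by rw [h x hx, inv_div]; ring

lemma exists_eq_const_of_inv_eq {I : Set ℝ} (hI : I.Nonempty) {c B : ℝ} {f : ℝ → ℝ}
    (hne : ∀ x ∈ I, f x ≠ 0) (h : ∀ x ∈ I, (f x)⁻¹ = 0 * Real.exp (-c * x) + B) :
    ∃ k : ℝ, k ≠ 0 ∧ ∀ x ∈ I, f x = k := by
  have hB : ∀ x ∈ I, f x = B⁻¹ := fun x hx => by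
    rw [← inv_inv (f x), h x hx, zero_mul, zero_add]
  obtain ⟨x, hx⟩ := hI
  exact ⟨B⁻¹, hB x hx ▸ hne x hx, hB⟩

lemma exists_eq_div_of_inv_eq {I : Set ℝ} {c A B : ℝ} (hA : A ≠ 0) {f : ℝ → ℝ}
    (hne : ∀ x ∈ I, f x ≠ 0) (h : ∀ x ∈ I, (f x)⁻¹ = A * Real.exp (-c * x) + B) :
    ∃ k : ℝ, k ≠ 0 ∧ ∃ a : ℝ, (∀ x ∈ I, Real.exp (-c * x) ≠ a) ∧
      ∀ x ∈ I, f x = k / (Real.exp (-c * x) - a) := by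
  have key : ∀ x ∈ I, (f x)⁻¹ = A * (Real.exp (-c * x) - -(B / A)) := fun x hx => by
    rw [h x hx]
    field_simp
    ring
  refine ⟨A⁻¹, inv_ne_zero hA, -(B / A), fun x hx he => ?_, fun x hx => ?_⟩
  · exact inv_ne_zero (hne x hx) (by rw [key x hx, he, sub_self, mul_zero])
  · rw [← inv_inv (f x), key x hx, mul_inv]; rfl

/-- Corollary 2.2 of the paper, in analytic form: with `f₁'/f₁ = c₀ ≠ 0` constant, the flatness
system holds iff `f₂, f₃` are both constant, or one of them is a nonzero constant and the other
equals `k/(e^{-c₀x} - c)` with `c ≠ e^{-c₀x}` on `I₁`. -/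
theorem stmt_2 (I₁ : Set ℝ) (hI₁open : IsOpen I₁) (hI₁conn : I₁.OrdConnected)
    (hI₁ne : I₁.Nonempty)
    (c₀ : ℝ) (hc₀ : c₀ ≠ 0)
    (f₁ f₂ f₃ : ℝ → ℝ)
    (hf₁smooth : ContDiffOn ℝ (⊤ : ℕ∞) f₁ I₁) (hf₁ne : ∀ x ∈ I₁, f₁ x ≠ 0)
    (hf₂smooth : ContDiffOn ℝ (⊤ : ℕ∞) f₂ I₁) (hf₂ne : ∀ x ∈ I₁, f₂ x ≠ 0)
    (hf₃smooth : ContDiffOn ℝ (⊤ : ℕ∞) f₃ I₁) (hf₃ne : ∀ x ∈ I₁, f₃ x ≠ 0)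
    (h₁ h₂ h₃ : ℝ → ℝ)
    (hh₁ : h₁ = fun x => deriv f₁ x / f₁ x)
    (hh₂ : h₂ = fun x => deriv f₂ x / f₂ x)
    (hh₃ : h₃ = fun x => deriv f₃ x / f₃ x)
    (hf₁log : ∀ x ∈ I₁, h₁ x = c₀) :
    (∀ x ∈ I₁, h₂ x * h₃ x = 0 ∧
        deriv h₂ x = h₂ x * (h₂ x - h₁ x) ∧
        deriv h₃ x = h₃ x * (h₃ x - h₁ x)) ↔
      ((∃ k₂ : ℝ, ∀ x ∈ I₁, f₂ x = k₂) ∧ (∃ k₃ : ℝ, ∀ x ∈ I₁, f₃ x = k₃)) ∨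
      ((∃ k₂ : ℝ, k₂ ≠ 0 ∧ ∀ x ∈ I₁, f₂ x = k₂) ∧
        ∃ k₃ : ℝ, k₃ ≠ 0 ∧ ∃ c₃ : ℝ, (∀ x ∈ I₁, Real.exp (-c₀ * x) ≠ c₃) ∧
          ∀ x ∈ I₁, f₃ x = k₃ / (Real.exp (-c₀ * x) - c₃)) ∨
      ((∃ k₃ : ℝ, k₃ ≠ 0 ∧ ∀ x ∈ I₁, f₃ x = k₃) ∧
        ∃ k₂ : ℝ, k₂ ≠ 0 ∧ ∃ c₂ : ℝ, (∀ x ∈ I₁, Real.exp (-c₀ * x) ≠ c₂) ∧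
          ∀ x ∈ I₁, f₂ x = k₂ / (Real.exp (-c₀ * x) - c₂)) := by
  have hconn : IsPreconnected I₁ := hI₁conn.isPreconnected
  subst hh₂ hh₃
  constructor
  · intro H
    obtain ⟨A₂, B₂, e₂⟩ := exists_inv_eq_of_deriv_logDeriv hI₁open hconn hc₀ hf₂smooth hf₂ne
      (fun x hx => by rw [(H x hx).2.1, hf₁log x hx])
    obtain ⟨A₃, B₃, e₃⟩ := exists_inv_eq_of_deriv_logDeriv hI₁open hconn hc₀ hf₃smooth hf₃ne
      (fun x hx => by rw [(H x hx).2.2, hf₁log x hx])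
    have hA : A₂ = 0 ∨ A₃ = 0 := by
      obtain ⟨x, hx⟩ := hI₁ne
      have hprod := (H x hx).1
      simp only [(logDeriv_eq_of_inv_eq hI₁open hf₂ne e₂ x hx).2,
        (logDeriv_eq_of_inv_eq hI₁open hf₃ne e₃ x hx).2] at hprod
      simpa [hc₀, hf₂ne x hx, hf₃ne x hx] using hprod
    by_cases h2 : A₂ = 0
    · subst h2
      obtain ⟨k₂, hk₂, hc₂⟩ := exists_eq_const_of_inv_eq hI₁ne hf₂ne e₂
      by_cases h3 : A₃ = 0
      · subst h3
        obtain ⟨k₃, -, hc₃⟩ := exists_eq_const_of_inv_eq hI₁ne hf₃ne e₃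
        exact Or.inl ⟨⟨k₂, hc₂⟩, k₃, hc₃⟩
      · exact Or.inr (Or.inl ⟨⟨k₂, hk₂, hc₂⟩, exists_eq_div_of_inv_eq h3 hf₃ne e₃⟩)
    · obtain rfl := hA.resolve_left h2
      exact Or.inr (Or.inr ⟨exists_eq_const_of_inv_eq hI₁ne hf₃ne e₃,
        exists_eq_div_of_inv_eq h2 hf₂ne e₂⟩)
  · intro H
    obtain ⟨A₂, B₂, A₃, B₃, hA, e₂, e₃⟩ : ∃ A₂ B₂ A₃ B₃ : ℝ, A₂ * A₃ = 0 ∧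
        (∀ x ∈ I₁, (f₂ x)⁻¹ = A₂ * Real.exp (-c₀ * x) + B₂) ∧
        ∀ x ∈ I₁, (f₃ x)⁻¹ = A₃ * Real.exp (-c₀ * x) + B₃ := by
      rcases H with ⟨⟨k₂, e₂⟩, k₃, e₃⟩ | ⟨⟨k₂, -, e₂⟩, k₃, -, a, -, e₃⟩ |
        ⟨⟨k₃, -, e₃⟩, k₂, -, a, -, e₂⟩
      · exact ⟨_, _, _, _, mul_zero _, inv_eq_of_eq_const e₂, inv_eq_of_eq_const e₃⟩
      · exact ⟨_, _, _, _, zero_mul _, inv_eq_of_eq_const e₂, inv_eq_of_eq_div e₃⟩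
      · exact ⟨_, _, _, _, mul_zero _, inv_eq_of_eq_div e₂, inv_eq_of_eq_const e₃⟩
    intro x hx
    rw [hf₁log x hx]
    refine ⟨?_, deriv_logDeriv_of_inv_eq hI₁open hf₂ne e₂ x hx,
      deriv_logDeriv_of_inv_eq hI₁open hf₃ne e₃ x hx⟩
    simp only [(logDeriv_eq_of_inv_eq hI₁open hf₂ne e₂ x hx).2,
      (logDeriv_eq_of_inv_eq hI₁open hf₃ne e₃ x hx).2]
    linear_combination (c₀ ^ 2 * Real.exp (-c₀ * x) ^ 2 * f₂ x * f₃ x) * hA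
end

section
/- Let I₁ ⊆ ℝ be an open interval and let f₁, f₂, f₃ : I₁ → ℝ be smooth nowhere-zero functions with f₁ constant; set hᵢ := fᵢ'/fᵢ. Then the system { h₂h₃ = 0, h₂' = h₂(h₂ − h₁), h₃' = h₃(h₃ − h₁) on I₁ } holds if and only if either f₂ and f₃ are both constant, or there is (i,j) ∈ {(2,3),(3,2)} such that fᵢ = kᵢ ∈ ℝ \ {0} is constant and fⱼ(x) = kⱼ/(x − cⱼ) for all x ∈ I₁, where kⱼ ∈ ℝ \ {0} and cⱼ ∈ ℝ \ I₁. -/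
/-- If the logarithmic derivative of `f` solves the Riccati equation `h' = h²` on an open interval,
then `1 / f` is affine there. -/
lemma exists_inv_eq_affine_of_deriv_logDeriv {s : Set ℝ} (hs : IsOpen s) (hc : s.OrdConnected)
    {f : ℝ → ℝ} (hf : ContDiffOn ℝ (⊤ : ℕ∞) f s) (hne : ∀ x ∈ s, f x ≠ 0)
    (h : ∀ x ∈ s, deriv (fun x => deriv f x / f x) x = (deriv f x / f x) ^ 2) :
    ∃ a b : ℝ, ∀ x ∈ s, f x = (a * x + b)⁻¹ := by
  have hd : ∀ x ∈ s, HasDerivAt f (deriv f x) x := fun x hx =>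
    ((hf.contDiffAt (hs.mem_nhds hx)).differentiableAt (by simp)).hasDerivAt
  have hd' : ∀ x ∈ s, DifferentiableAt ℝ (deriv f) x := fun x hx =>
    ((hf.deriv_of_isOpen (m := 1) hs (one_add_one_eq_two.trans_le ENat.LEInfty.out)).contDiffAt
      (hs.mem_nhds hx)).differentiableAt (by simp)
  have hw : ∀ x ∈ s, HasDerivAt (fun x => deriv f x / f x / f x) 0 x := by
    intro x hx
    have h1 := ((hd' x hx).div (hd x hx).differentiableAt (hne x hx)).hasDerivAt
    have h2 : HasDerivAt (fun x => deriv f x / f x) ((deriv f x / f x) ^ 2) x := h x hx ▸ h1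
    refine (h2.div (hd x hx) (hne x hx)).congr_deriv ?_
    have := hne x hx
    field_simp
    ring
  have hpre : IsPreconnected s := hc.isPreconnected
  obtain ⟨a, ha⟩ := hs.exists_is_const_of_deriv_eq_zero hpre
    (fun x hx => (hw x hx).differentiableAt.differentiableWithinAt) (fun x hx => (hw x hx).deriv)
  have hu : ∀ x ∈ s, HasDerivAt (fun x => (f x)⁻¹ + a * x) 0 x := by
    intro x hx
    refine (((hd x hx).inv (hne x hx)).add ((hasDerivAt_id x).const_mul a)).congr_deriv ?_
    rw [← ha x hx]
    have := hne x hx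
    field_simp
    ring
  obtain ⟨b, hb⟩ := hs.exists_is_const_of_deriv_eq_zero hpre
    (fun x hx => (hu x hx).differentiableAt.differentiableWithinAt) (fun x hx => (hu x hx).deriv)
  refine ⟨-a, b, fun x hx => ?_⟩
  rw [← hb x hx, neg_mul, neg_add_cancel_comm_assoc, inv_inv]

lemma hasDerivAt_of_eq_inv_affine {s : Set ℝ} (hs : IsOpen s) {f : ℝ → ℝ}
    (hne : ∀ x ∈ s, f x ≠ 0) {a b : ℝ} (h : ∀ x ∈ s, f x = (a * x + b)⁻¹) {x : ℝ} (hx : x ∈ s) :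
    HasDerivAt f (-a * f x ^ 2) x := by
  have hx0 : a * x + b ≠ 0 := fun h0 => hne x hx (by rw [h x hx, h0, inv_zero])
  have h1 : HasDerivAt (fun y => (a * y + b)⁻¹) (-a * f x ^ 2) x := by
    refine ((((hasDerivAt_id x).const_mul a).add_const b).inv hx0).congr_deriv ?_
    rw [h x hx]
    simp only [id]
    field_simp
  exact h1.congr_of_eventuallyEq (Filter.eventuallyEq_of_mem (hs.mem_nhds hx) h)

lemma logDeriv_eq_of_eq_inv_affine {s : Set ℝ} (hs : IsOpen s) {f : ℝ → ℝ}
    (hne : ∀ x ∈ s, f x ≠ 0) {a b : ℝ} (h : ∀ x ∈ s, f x = (a * x + b)⁻¹) {x : ℝ} (hx : x ∈ s) :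
    deriv f x / f x = -a * f x := by
  rw [(hasDerivAt_of_eq_inv_affine hs hne h hx).deriv]
  have := hne x hx
  field_simp

lemma deriv_logDeriv_of_eq_inv_affine {s : Set ℝ} (hs : IsOpen s) {f : ℝ → ℝ}
    (hne : ∀ x ∈ s, f x ≠ 0) {a b : ℝ} (h : ∀ x ∈ s, f x = (a * x + b)⁻¹) {x : ℝ} (hx : x ∈ s) :
    deriv (fun x => deriv f x / f x) x = (deriv f x / f x) ^ 2 := by
  have he : (fun x => deriv f x / f x) =ᶠ[nhds x] fun x => -a * f x :=
    Filter.eventuallyEq_of_mem (hs.mem_nhds hx)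
      fun y hy => logDeriv_eq_of_eq_inv_affine hs hne h hy
  rw [he.deriv_eq, logDeriv_eq_of_eq_inv_affine hs hne h hx,
    ((hasDerivAt_of_eq_inv_affine hs hne h hx).const_mul (-a)).deriv]
  ring

lemma exists_eq_div_sub_of_eq_inv_affine {s : Set ℝ} {f : ℝ → ℝ}
    (hne : ∀ x ∈ s, f x ≠ 0) {a b : ℝ} (ha : a ≠ 0) (h : ∀ x ∈ s, f x = (a * x + b)⁻¹) :
    ∃ k : ℝ, k ≠ 0 ∧ ∃ c : ℝ, c ∉ s ∧ ∀ x ∈ s, f x = k / (x - c) := by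
  refine ⟨a⁻¹, inv_ne_zero ha, -b / a, fun hc => hne _ hc ?_, fun x hx => ?_⟩
  · rw [h _ hc, mul_div_cancel₀ _ ha, neg_add_cancel, inv_zero]
  · rw [h x hx, div_eq_mul_inv, ← mul_inv]
    congr 1
    field_simp
    ring

lemma eq_inv_affine_of_eq_div_sub {s : Set ℝ} {f : ℝ → ℝ} {k c : ℝ}
    (h : ∀ x ∈ s, f x = k / (x - c)) :
    ∀ x ∈ s, f x = (k⁻¹ * x + -(k⁻¹ * c))⁻¹ := by
  intro x hx
  rw [h x hx, ← sub_eq_add_neg, ← mul_sub, mul_inv, inv_inv, div_eq_mul_inv]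

lemma eq_inv_affine_of_eq_const {s : Set ℝ} {f : ℝ → ℝ} {k : ℝ} (h : ∀ x ∈ s, f x = k) :
    ∀ x ∈ s, f x = (0 * x + k⁻¹)⁻¹ := by
  simpa using h

/-- Corollary 2.3 of the paper, in analytic form: with `f₁` constant, the flatness system holds
iff `f₂, f₃` are both constant, or one of them is a nonzero constant and the other equals
`k/(x - c)` with `c ∉ I₁`. -/
theorem stmt_3 (I₁ : Set ℝ) (hI₁open : IsOpen I₁) (hI₁conn : I₁.OrdConnected)
    (hI₁ne : I₁.Nonempty)
    (f₁ f₂ f₃ : ℝ → ℝ)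
    (hf₁smooth : ContDiffOn ℝ (⊤ : ℕ∞) f₁ I₁) (hf₁ne : ∀ x ∈ I₁, f₁ x ≠ 0)
    (hf₂smooth : ContDiffOn ℝ (⊤ : ℕ∞) f₂ I₁) (hf₂ne : ∀ x ∈ I₁, f₂ x ≠ 0)
    (hf₃smooth : ContDiffOn ℝ (⊤ : ℕ∞) f₃ I₁) (hf₃ne : ∀ x ∈ I₁, f₃ x ≠ 0)
    (hf₁const : ∃ k₁ : ℝ, ∀ x ∈ I₁, f₁ x = k₁)
    (h₁ h₂ h₃ : ℝ → ℝ)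
    (hh₁ : h₁ = fun x => deriv f₁ x / f₁ x)
    (hh₂ : h₂ = fun x => deriv f₂ x / f₂ x)
    (hh₃ : h₃ = fun x => deriv f₃ x / f₃ x) :
    (∀ x ∈ I₁, h₂ x * h₃ x = 0 ∧
        deriv h₂ x = h₂ x * (h₂ x - h₁ x) ∧
        deriv h₃ x = h₃ x * (h₃ x - h₁ x)) ↔
      ((∃ k₂ : ℝ, ∀ x ∈ I₁, f₂ x = k₂) ∧ (∃ k₃ : ℝ, ∀ x ∈ I₁, f₃ x = k₃)) ∨
      ((∃ k₂ : ℝ, k₂ ≠ 0 ∧ ∀ x ∈ I₁, f₂ x = k₂) ∧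
        ∃ k₃ : ℝ, k₃ ≠ 0 ∧ ∃ c₃ : ℝ, c₃ ∉ I₁ ∧
          ∀ x ∈ I₁, f₃ x = k₃ / (x - c₃)) ∨
      ((∃ k₃ : ℝ, k₃ ≠ 0 ∧ ∀ x ∈ I₁, f₃ x = k₃) ∧
        ∃ k₂ : ℝ, k₂ ≠ 0 ∧ ∃ c₂ : ℝ, c₂ ∉ I₁ ∧
          ∀ x ∈ I₁, f₂ x = k₂ / (x - c₂)) := by
  subst hh₁ hh₂ hh₃
  obtain ⟨k₁, hk₁⟩ := hf₁const
  have hh₁0 : ∀ x ∈ I₁, deriv f₁ x / f₁ x = 0 := fun x hx => by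
    simpa using logDeriv_eq_of_eq_inv_affine hI₁open hf₁ne (eq_inv_affine_of_eq_const hk₁) hx
  have key : ∀ a₂ b₂ a₃ b₃ : ℝ, (∀ x ∈ I₁, f₂ x = (a₂ * x + b₂)⁻¹) →
      (∀ x ∈ I₁, f₃ x = (a₃ * x + b₃)⁻¹) → a₂ * a₃ = 0 →
      ∀ x ∈ I₁, deriv f₂ x / f₂ x * (deriv f₃ x / f₃ x) = 0 ∧
        deriv (fun x => deriv f₂ x / f₂ x) x =
          deriv f₂ x / f₂ x * (deriv f₂ x / f₂ x - deriv f₁ x / f₁ x) ∧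
        deriv (fun x => deriv f₃ x / f₃ x) x =
          deriv f₃ x / f₃ x * (deriv f₃ x / f₃ x - deriv f₁ x / f₁ x) := by
    intro a₂ b₂ a₃ b₃ h2 h3 h0 x hx
    rw [hh₁0 x hx, sub_zero, sub_zero, ← sq, ← sq]
    refine ⟨?_, deriv_logDeriv_of_eq_inv_affine hI₁open hf₂ne h2 hx,
      deriv_logDeriv_of_eq_inv_affine hI₁open hf₃ne h3 hx⟩
    rw [logDeriv_eq_of_eq_inv_affine hI₁open hf₂ne h2 hx,
      logDeriv_eq_of_eq_inv_affine hI₁open hf₃ne h3 hx]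
    linear_combination f₂ x * f₃ x * h0
  constructor
  · intro H
    beta_reduce at H
    obtain ⟨a₂, b₂, h2⟩ := exists_inv_eq_affine_of_deriv_logDeriv hI₁open hI₁conn hf₂smooth hf₂ne
      fun x hx => by rw [(H x hx).2.1, hh₁0 x hx, sub_zero, sq]
    obtain ⟨a₃, b₃, h3⟩ := exists_inv_eq_affine_of_deriv_logDeriv hI₁open hI₁conn hf₃smooth hf₃ne
      fun x hx => by rw [(H x hx).2.2, hh₁0 x hx, sub_zero, sq]
    obtain ⟨x₀, hx₀⟩ := hI₁ne
    have hmul : a₂ = 0 ∨ a₃ = 0 := by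
      have := (H x₀ hx₀).1
      rw [logDeriv_eq_of_eq_inv_affine hI₁open hf₂ne h2 hx₀,
        logDeriv_eq_of_eq_inv_affine hI₁open hf₃ne h3 hx₀] at this
      simpa [hf₂ne x₀ hx₀, hf₃ne x₀ hx₀] using this
    have hconst : ∀ {f : ℝ → ℝ} {a b : ℝ}, (∀ x ∈ I₁, f x ≠ 0) → a = 0 →
        (∀ x ∈ I₁, f x = (a * x + b)⁻¹) → ∃ k : ℝ, k ≠ 0 ∧ ∀ x ∈ I₁, f x = k := by
      intro f a b hne ha h
      have h' : ∀ x ∈ I₁, f x = b⁻¹ := by simpa [ha] using h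
      exact ⟨b⁻¹, h' x₀ hx₀ ▸ hne x₀ hx₀, h'⟩
    by_cases ha₂ : a₂ = 0
    · obtain ⟨k₂, hk₂, hc₂⟩ := hconst hf₂ne ha₂ h2
      by_cases ha₃ : a₃ = 0
      · obtain ⟨k₃, -, hc₃⟩ := hconst hf₃ne ha₃ h3
        exact Or.inl ⟨⟨k₂, hc₂⟩, k₃, hc₃⟩
      · exact Or.inr (Or.inl ⟨⟨k₂, hk₂, hc₂⟩, exists_eq_div_sub_of_eq_inv_affine hf₃ne ha₃ h3⟩)
    · exact Or.inr (Or.inr ⟨hconst hf₃ne (hmul.resolve_left ha₂) h3,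
        exists_eq_div_sub_of_eq_inv_affine hf₂ne ha₂ h2⟩)
  · rintro (⟨⟨k₂, h2⟩, k₃, h3⟩ | ⟨⟨k₂, -, h2⟩, k₃, -, c₃, -, h3⟩ | ⟨⟨k₃, -, h3⟩, k₂, -, c₂, -, h2⟩)
    · exact key _ _ _ _ (eq_inv_affine_of_eq_const h2) (eq_inv_affine_of_eq_const h3) (zero_mul _)
    · exact key _ _ _ _ (eq_inv_affine_of_eq_const h2) (eq_inv_affine_of_eq_div_sub h3) (zero_mul _)
    · exact key _ _ _ _ (eq_inv_affine_of_eq_div_sub h2) (eq_inv_affine_of_eq_const h3) (mul_zero _)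
end

section
/- Let f₁, f₂, f₃ : ℝ → ℝ be smooth nowhere-zero functions with f₁ constant; set hᵢ := fᵢ'/fᵢ. Then the system { h₂h₃ = 0, h₂' = h₂(h₂ − h₁), h₃' = h₃(h₃ − h₁) on ℝ } holds if and only if f₁, f₂, and f₃ are all constant. -/
/-- If the logarithmic derivative `h` of a smooth nowhere-zero function satisfies `h' = h ^ 2` on
all of `ℝ`, then the function is constant: its reciprocal is affine and has no zero. -/
theorem exists_eq_const_of_deriv_logDeriv_eq_sq {f : ℝ → ℝ} (hf : ContDiff ℝ (⊤ : ℕ∞) f)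
    (hne : ∀ x, f x ≠ 0)
    (hode : ∀ x, deriv (fun y => deriv f y / f y) x = (deriv f x / f x) ^ 2) :
    ∃ k : ℝ, ∀ x, f x = k := by
  have hd : Differentiable ℝ f := hf.differentiable (by simp)
  have hd' : Differentiable ℝ (deriv f) :=
    (contDiff_infty_iff_deriv.mp hf).2.differentiable (by simp)
  have hinv : ∀ x, HasDerivAt (fun y => (f y)⁻¹) (-(deriv f x / f x) * (f x)⁻¹) x := by
    intro x
    refine HasDerivAt.congr_deriv ((hd x).hasDerivAt.fun_inv (hne x)) ?_
    field_simp [hne x]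
  have hlog : ∀ x, HasDerivAt (fun y => deriv f y / f y) ((deriv f x / f x) ^ 2) x := by
    intro x
    rw [← hode x]
    exact ((hd' x).fun_div (hd x) (hne x)).hasDerivAt
  have hslope : ∀ x, HasDerivAt (fun y => -(deriv f y / f y) * (f y)⁻¹) 0 x := by
    intro x
    refine HasDerivAt.congr_deriv ((hlog x).fun_neg.fun_mul (hinv x)) ?_
    ring
  obtain ⟨c, hc⟩ : ∃ c : ℝ, ∀ x, -(deriv f x / f x) * (f x)⁻¹ = c :=
    ⟨_, fun x => is_const_of_deriv_eq_zero (fun y => (hslope y).differentiableAt)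
      (fun y => (hslope y).deriv) x 0⟩
  have haffine : ∀ x, (f x)⁻¹ - c * x = (f 0)⁻¹ := by
    have hdiff : ∀ x, HasDerivAt (fun y => (f y)⁻¹ - c * y) 0 x := by
      intro x
      refine HasDerivAt.congr_deriv ((hinv x).fun_sub ((hasDerivAt_id' x).const_mul c)) ?_
      rw [hc x]
      ring
    intro x
    simpa using is_const_of_deriv_eq_zero (fun y => (hdiff y).differentiableAt)
      (fun y => (hdiff y).deriv) x 0
  have hc0 : c = 0 := by
    by_contra hcne
    have hzero := haffine (-(f 0)⁻¹ / c)
    rw [mul_div_cancel₀ _ hcne] at hzero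
    exact inv_ne_zero (hne (-(f 0)⁻¹ / c)) (by linarith)
  refine ⟨f 0, fun x => inv_injective ?_⟩
  simpa [hc0] using haffine x

/-- Corollary 2.4 of the paper, in analytic form: for smooth nowhere-zero `f₁, f₂, f₃ : ℝ → ℝ`
with `f₁` constant, the flatness system holds on all of `ℝ` iff `f₁, f₂, f₃` are all constant. -/
theorem stmt_4 (f₁ f₂ f₃ : ℝ → ℝ)
    (hf₁smooth : ContDiff ℝ (⊤ : ℕ∞) f₁) (hf₁ne : ∀ x : ℝ, f₁ x ≠ 0)
    (hf₂smooth : ContDiff ℝ (⊤ : ℕ∞) f₂) (hf₂ne : ∀ x : ℝ, f₂ x ≠ 0)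
    (hf₃smooth : ContDiff ℝ (⊤ : ℕ∞) f₃) (hf₃ne : ∀ x : ℝ, f₃ x ≠ 0)
    (hf₁const : ∃ k₁ : ℝ, ∀ x : ℝ, f₁ x = k₁)
    (h₁ h₂ h₃ : ℝ → ℝ)
    (hh₁ : h₁ = fun x => deriv f₁ x / f₁ x)
    (hh₂ : h₂ = fun x => deriv f₂ x / f₂ x)
    (hh₃ : h₃ = fun x => deriv f₃ x / f₃ x) :
    (∀ x : ℝ, h₂ x * h₃ x = 0 ∧
        deriv h₂ x = h₂ x * (h₂ x - h₁ x) ∧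
        deriv h₃ x = h₃ x * (h₃ x - h₁ x)) ↔
      (∃ k₁ : ℝ, ∀ x : ℝ, f₁ x = k₁) ∧
      (∃ k₂ : ℝ, ∀ x : ℝ, f₂ x = k₂) ∧
      (∃ k₃ : ℝ, ∀ x : ℝ, f₃ x = k₃) := by
  subst hh₁ hh₂ hh₃
  constructor
  · intro h
    have hzero : ∀ x, deriv f₁ x = 0 := by
      obtain ⟨k, hk⟩ := hf₁const
      intro x
      rw [funext hk, deriv_const]
    refine ⟨hf₁const, exists_eq_const_of_deriv_logDeriv_eq_sq hf₂smooth hf₂ne fun x => ?_,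
      exists_eq_const_of_deriv_logDeriv_eq_sq hf₃smooth hf₃ne fun x => ?_⟩
    · simpa [hzero, sq] using (h x).2.1
    · simpa [hzero, sq] using (h x).2.2
  · rintro ⟨-, ⟨k₂, hk₂⟩, ⟨k₃, hk₃⟩⟩ x
    simp [funext hk₂, funext hk₃]
end

section
/- Let I₁, I₂, I₃ ⊆ ℝ be open intervals and let f₁ : I₂ → ℝ, f₂ : I₃ → ℝ, f₃ : I₁ → ℝ be smooth nowhere-zero functions; set h₁ := f₁'/f₁, h₂ := f₂'/f₂, h₃ := f₃'/f₃. Then the system { f₁(x²)²(h₃'(x¹) − h₃(x¹)²) = −f₂(x³)²(h₁'(x²) − h₁(x²)²), f₂(x³)²(h₁'(x²) − h₁(x²)²) = −f₃(x¹)²(h₂'(x³) − h₂(x³)²), f₁(x²)²(h₃'(x¹) − h₃(x¹)²) = −f₃(x¹)²(h₂'(x³) − h₂(x³)²), f₁'(x²)f₂'(x³) = f₂'(x³)f₃'(x¹) = f₃'(x¹)f₁'(x²) = 0, for all x¹ ∈ I₁, x² ∈ I₂, x³ ∈ I₃ } holds if and only if one of the following holds: (1) f₁, f₂, f₃ are all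 constant; (2) f₁, f₂ are constant and f₃(x¹) = k₃/(x¹ − c₃) with k₃ ∈ ℝ \ {0}, c₃ ∈ ℝ \ I₁; (3) f₂, f₃ are constant and f₁(x²) = k₁/(x² − c₁) with k₁ ∈ ℝ \ {0}, c₁ ∈ ℝ \ I₂; (4) f₁, f₃ are constant and f₂(x³) = k₂/(x³ − c₂) with k₂ ∈ ℝ \ {0}, c₂ ∈ ℝ \ I₃. -/
/-- On an open interval, a nowhere-zero smooth function whose logarithmic derivative `h` satisfies
`h' = h ^ 2` is either constant or a multiple of `1 / (x - c)`, because `1 / f` is affine. -/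
lemma const_or_eq_div_sub_of_deriv_logDeriv {I : Set ℝ} (hI : IsOpen I) (hc : I.OrdConnected)
    {f : ℝ → ℝ} (hf : ContDiffOn ℝ (⊤ : ℕ∞) f I) (hne : ∀ x ∈ I, f x ≠ 0)
    (hA : ∀ x ∈ I, deriv (fun x => deriv f x / f x) x - (deriv f x / f x) ^ 2 = 0) :
    (∃ k : ℝ, ∀ x ∈ I, f x = k) ∨
      ∃ k : ℝ, k ≠ 0 ∧ ∃ c : ℝ, c ∉ I ∧ ∀ x ∈ I, f x = k / (x - c) := by
  have hpc : IsPreconnected I := hc.isPreconnected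
  have hd : ∀ x ∈ I, HasDerivAt f (deriv f x) x := fun x hx =>
    ((hf.differentiableOn (by simp)).differentiableAt (hI.mem_nhds hx)).hasDerivAt
  have hd2 : ∀ x ∈ I, DifferentiableAt ℝ (deriv f) x := fun x hx =>
    ((hf.deriv_of_isOpen (m := 1) hI (by norm_cast)).differentiableOn
      (by simp)).differentiableAt (hI.mem_nhds hx)
  have hu : ∀ x ∈ I, HasDerivAt (fun y => (f y)⁻¹) (-(deriv f x / f x) / f x) x := by
    intro x hx
    have h : -(deriv f x / f x) / f x = -deriv f x / f x ^ 2 := by ring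
    rw [h]
    exact (hd x hx).fun_inv (hne x hx)
  have hv : ∀ x ∈ I, HasDerivAt (fun y => -(deriv f y / f y) / f y) 0 x := by
    intro x hx
    have h := hne x hx
    have hh : HasDerivAt (fun y => deriv f y / f y) ((deriv f x / f x) ^ 2) x := by
      rw [← sub_eq_zero.mp (hA x hx)]
      exact ((hd2 x hx).div (hd x hx).differentiableAt h).hasDerivAt
    have e : (-(deriv f x / f x) ^ 2 * f x - -(deriv f x / f x) * deriv f x) / f x ^ 2 = 0 := by
      field_simp
      ring
    rw [← e]
    exact hh.fun_neg.fun_div (hd x hx) h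
  obtain ⟨a, ha⟩ := hI.exists_is_const_of_deriv_eq_zero hpc
    (fun x hx => (hv x hx).differentiableAt.differentiableWithinAt) (fun x hx => (hv x hx).deriv)
  have hw : ∀ x ∈ I, HasDerivAt (fun y => (f y)⁻¹ - a * y) 0 x := by
    intro x hx
    simpa [ha x hx] using (hu x hx).fun_sub ((hasDerivAt_id x).const_mul a)
  obtain ⟨b, hb⟩ := hI.exists_is_const_of_deriv_eq_zero hpc
    (fun x hx => (hw x hx).differentiableAt.differentiableWithinAt) (fun x hx => (hw x hx).deriv)
  have hfx : ∀ x ∈ I, f x = (a * x + b)⁻¹ := fun x hx => by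
    rw [← hb x hx]; simp
  by_cases h0 : a = 0
  · exact .inl ⟨b⁻¹, fun x hx => by simp [hfx x hx, h0]⟩
  · refine .inr ⟨a⁻¹, inv_ne_zero h0, -b / a, fun hx => hne _ hx ?_, fun x hx => ?_⟩
    · rw [hfx _ hx]
      field_simp
      simp
    · rw [hfx x hx, div_eq_mul_inv, ← mul_inv]
      congr 1
      field_simp
      ring

lemma deriv_eq_zero_of_const_on {I : Set ℝ} (hI : IsOpen I) {f : ℝ → ℝ} {k : ℝ}
    (hk : ∀ x ∈ I, f x = k) {x : ℝ} (hx : x ∈ I) : deriv f x = 0 := by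
  have h : f =ᶠ[nhds x] fun _ => k := Filter.eventually_of_mem (hI.mem_nhds hx) hk
  rw [h.deriv_eq, deriv_const]

lemma deriv_logDeriv_of_const_on {I : Set ℝ} (hI : IsOpen I) {f : ℝ → ℝ} {k : ℝ}
    (hk : ∀ x ∈ I, f x = k) {x : ℝ} (hx : x ∈ I) :
    deriv (fun x => deriv f x / f x) x - (deriv f x / f x) ^ 2 = 0 := by
  have h : ∀ y ∈ I, deriv f y / f y = 0 := fun y hy => by
    rw [deriv_eq_zero_of_const_on hI hk hy, zero_div]
  rw [deriv_eq_zero_of_const_on hI h hx, h x hx]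
  simp

lemma deriv_of_eq_div_sub {I : Set ℝ} (hI : IsOpen I) {f : ℝ → ℝ} {k c : ℝ} (hc : c ∉ I)
    (hk : ∀ x ∈ I, f x = k / (x - c)) {x : ℝ} (hx : x ∈ I) :
    deriv f x = -k / (x - c) ^ 2 := by
  have hxc : x - c ≠ 0 := sub_ne_zero.mpr fun h => hc (h ▸ hx)
  have h : f =ᶠ[nhds x] fun y => k / (y - c) := Filter.eventually_of_mem (hI.mem_nhds hx) hk
  rw [h.deriv_eq]
  simpa using ((hasDerivAt_const x k).fun_div ((hasDerivAt_id x).sub_const c) hxc).deriv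

lemma deriv_logDeriv_of_eq_div_sub {I : Set ℝ} (hI : IsOpen I) {f : ℝ → ℝ} {k c : ℝ} (hk0 : k ≠ 0)
    (hc : c ∉ I) (hk : ∀ x ∈ I, f x = k / (x - c)) {x : ℝ} (hx : x ∈ I) :
    deriv (fun x => deriv f x / f x) x - (deriv f x / f x) ^ 2 = 0 := by
  have h : ∀ y ∈ I, deriv f y / f y = -1 / (y - c) := fun y hy => by
    have hyc : y - c ≠ 0 := sub_ne_zero.mpr fun h => hc (h ▸ hy)
    rw [deriv_of_eq_div_sub hI hc hk hy, hk y hy]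
    field_simp
  rw [deriv_of_eq_div_sub hI hc h hx, h x hx, div_pow]
  simp

/-- Theorem 2.5 of the paper, in analytic form: for smooth nowhere-zero `f₁ : I₂ → ℝ`,
`f₂ : I₃ → ℝ`, `f₃ : I₁ → ℝ` with `hᵢ = fᵢ'/fᵢ`, the flatness system holds iff all three
functions are constant, or exactly one of them is of the form `k/(x - c)` with pole `c` outside
its interval and the other two are constant. -/
theorem stmt_6 (I₁ I₂ I₃ : Set ℝ)
    (hI₁open : IsOpen I₁) (hI₁conn : I₁.OrdConnected) (hI₁ne : I₁.Nonempty)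
    (hI₂open : IsOpen I₂) (hI₂conn : I₂.OrdConnected) (hI₂ne : I₂.Nonempty)
    (hI₃open : IsOpen I₃) (hI₃conn : I₃.OrdConnected) (hI₃ne : I₃.Nonempty)
    (f₁ f₂ f₃ : ℝ → ℝ)
    (hf₁smooth : ContDiffOn ℝ (⊤ : ℕ∞) f₁ I₂) (hf₁ne : ∀ x ∈ I₂, f₁ x ≠ 0)
    (hf₂smooth : ContDiffOn ℝ (⊤ : ℕ∞) f₂ I₃) (hf₂ne : ∀ x ∈ I₃, f₂ x ≠ 0)
    (hf₃smooth : ContDiffOn ℝ (⊤ : ℕ∞) f₃ I₁) (hf₃ne : ∀ x ∈ I₁, f₃ x ≠ 0)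
    (h₁ h₂ h₃ : ℝ → ℝ)
    (hh₁ : h₁ = fun x => deriv f₁ x / f₁ x)
    (hh₂ : h₂ = fun x => deriv f₂ x / f₂ x)
    (hh₃ : h₃ = fun x => deriv f₃ x / f₃ x) :
    (∀ x1 ∈ I₁, ∀ x2 ∈ I₂, ∀ x3 ∈ I₃,
        (f₁ x2) ^ 2 * (deriv h₃ x1 - (h₃ x1) ^ 2) =
          -((f₂ x3) ^ 2 * (deriv h₁ x2 - (h₁ x2) ^ 2)) ∧
        (f₂ x3) ^ 2 * (deriv h₁ x2 - (h₁ x2) ^ 2) =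
          -((f₃ x1) ^ 2 * (deriv h₂ x3 - (h₂ x3) ^ 2)) ∧
        (f₁ x2) ^ 2 * (deriv h₃ x1 - (h₃ x1) ^ 2) =
          -((f₃ x1) ^ 2 * (deriv h₂ x3 - (h₂ x3) ^ 2)) ∧
        deriv f₁ x2 * deriv f₂ x3 = 0 ∧
        deriv f₂ x3 * deriv f₃ x1 = 0 ∧
        deriv f₃ x1 * deriv f₁ x2 = 0) ↔
      ((∃ k₁ : ℝ, ∀ x ∈ I₂, f₁ x = k₁) ∧ (∃ k₂ : ℝ, ∀ x ∈ I₃, f₂ x = k₂) ∧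
        (∃ k₃ : ℝ, ∀ x ∈ I₁, f₃ x = k₃)) ∨
      ((∃ k₁ : ℝ, ∀ x ∈ I₂, f₁ x = k₁) ∧ (∃ k₂ : ℝ, ∀ x ∈ I₃, f₂ x = k₂) ∧
        ∃ k₃ : ℝ, k₃ ≠ 0 ∧ ∃ c₃ : ℝ, c₃ ∉ I₁ ∧ ∀ x ∈ I₁, f₃ x = k₃ / (x - c₃)) ∨
      ((∃ k₂ : ℝ, ∀ x ∈ I₃, f₂ x = k₂) ∧ (∃ k₃ : ℝ, ∀ x ∈ I₁, f₃ x = k₃) ∧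
        ∃ k₁ : ℝ, k₁ ≠ 0 ∧ ∃ c₁ : ℝ, c₁ ∉ I₂ ∧ ∀ x ∈ I₂, f₁ x = k₁ / (x - c₁)) ∨
      ((∃ k₁ : ℝ, ∀ x ∈ I₂, f₁ x = k₁) ∧ (∃ k₃ : ℝ, ∀ x ∈ I₁, f₃ x = k₃) ∧
        ∃ k₂ : ℝ, k₂ ≠ 0 ∧ ∃ c₂ : ℝ, c₂ ∉ I₃ ∧ ∀ x ∈ I₃, f₂ x = k₂ / (x - c₂)) := by
  subst hh₁ hh₂ hh₃
  constructor
  · intro H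
    obtain ⟨p, hp⟩ := hI₁ne
    obtain ⟨q, hq⟩ := hI₂ne
    obtain ⟨r, hr⟩ := hI₃ne
    have nd {I : Set ℝ} (hI : IsOpen I) {f : ℝ → ℝ} {k c x : ℝ} (hk0 : k ≠ 0) (hc : c ∉ I)
        (hk : ∀ x ∈ I, f x = k / (x - c)) (hx : x ∈ I) : deriv f x ≠ 0 := by
      rw [deriv_of_eq_div_sub hI hc hk hx]
      exact div_ne_zero (neg_ne_zero.mpr hk0)
        (pow_ne_zero 2 (sub_ne_zero.mpr fun h => hc (h ▸ hx)))
    have d₁ := const_or_eq_div_sub_of_deriv_logDeriv hI₂open hI₂conn hf₁smooth hf₁ne fun x hx => by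
      obtain ⟨e₁, e₂, e₃, -⟩ := H p hp x hx r hr
      exact (mul_eq_zero.mp (by linarith)).resolve_left (pow_ne_zero 2 (hf₂ne r hr))
    have d₂ := const_or_eq_div_sub_of_deriv_logDeriv hI₃open hI₃conn hf₂smooth hf₂ne fun x hx => by
      obtain ⟨e₁, e₂, e₃, -⟩ := H p hp q hq x hx
      exact (mul_eq_zero.mp (by linarith)).resolve_left (pow_ne_zero 2 (hf₃ne p hp))
    have d₃ := const_or_eq_div_sub_of_deriv_logDeriv hI₁open hI₁conn hf₃smooth hf₃ne fun x hx => by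
      obtain ⟨e₁, e₂, e₃, -⟩ := H x hx q hq r hr
      exact (mul_eq_zero.mp (by linarith)).resolve_left (pow_ne_zero 2 (hf₁ne q hq))
    obtain ⟨-, -, -, e₁₂, e₂₃, e₃₁⟩ := H p hp q hq r hr
    rcases d₁ with c₁ | ⟨k, hk, c, hc, h₁⟩
    · rcases d₂ with c₂ | ⟨k, hk, c, hc, h₂⟩
      · rcases d₃ with c₃ | c₃
        · exact .inl ⟨c₁, c₂, c₃⟩
        · exact .inr (.inl ⟨c₁, c₂, c₃⟩)
      · rcases d₃ with c₃ | ⟨k', hk', c', hc', h₃⟩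
        · exact .inr (.inr (.inr ⟨c₁, c₃, k, hk, c, hc, h₂⟩))
        · exact absurd e₂₃
            (mul_ne_zero (nd hI₃open hk hc h₂ hr) (nd hI₁open hk' hc' h₃ hp))
    · rcases d₂ with c₂ | ⟨k', hk', c', hc', h₂⟩
      · rcases d₃ with c₃ | ⟨k', hk', c', hc', h₃⟩
        · exact .inr (.inr (.inl ⟨c₂, c₃, k, hk, c, hc, h₁⟩))
        · exact absurd e₃₁
            (mul_ne_zero (nd hI₁open hk' hc' h₃ hp) (nd hI₂open hk hc h₁ hq))
      · exact absurd e₁₂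
          (mul_ne_zero (nd hI₂open hk hc h₁ hq) (nd hI₃open hk' hc' h₂ hr))
  · rintro (⟨⟨k₁, h₁⟩, ⟨k₂, h₂⟩, ⟨k₃, h₃⟩⟩ | ⟨⟨k₁, h₁⟩, ⟨k₂, h₂⟩, k, hk, c, hc, h₃⟩ |
      ⟨⟨k₂, h₂⟩, ⟨k₃, h₃⟩, k, hk, c, hc, h₁⟩ | ⟨⟨k₁, h₁⟩, ⟨k₃, h₃⟩, k, hk, c, hc, h₂⟩)
      x1 hx1 x2 hx2 x3 hx3
    · simp only [deriv_logDeriv_of_const_on hI₂open h₁ hx2,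
        deriv_logDeriv_of_const_on hI₃open h₂ hx3, deriv_logDeriv_of_const_on hI₁open h₃ hx1]
      simp only [deriv_eq_zero_of_const_on hI₂open h₁ hx2, deriv_eq_zero_of_const_on hI₃open h₂ hx3]
      simp
    · simp only [deriv_logDeriv_of_const_on hI₂open h₁ hx2,
        deriv_logDeriv_of_const_on hI₃open h₂ hx3,
        deriv_logDeriv_of_eq_div_sub hI₁open hk hc h₃ hx1]
      simp only [deriv_eq_zero_of_const_on hI₂open h₁ hx2, deriv_eq_zero_of_const_on hI₃open h₂ hx3]
      simp
    · simp only [deriv_logDeriv_of_eq_div_sub hI₂open hk hc h₁ hx2,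
        deriv_logDeriv_of_const_on hI₃open h₂ hx3, deriv_logDeriv_of_const_on hI₁open h₃ hx1]
      simp only [deriv_eq_zero_of_const_on hI₃open h₂ hx3, deriv_eq_zero_of_const_on hI₁open h₃ hx1]
      simp
    · simp only [deriv_logDeriv_of_const_on hI₂open h₁ hx2,
        deriv_logDeriv_of_eq_div_sub hI₃open hk hc h₂ hx3,
        deriv_logDeriv_of_const_on hI₁open h₃ hx1]
      simp only [deriv_eq_zero_of_const_on hI₂open h₁ hx2, deriv_eq_zero_of_const_on hI₁open h₃ hx1]
      simp
end

section
/- Let I₁, I₂ ⊆ ℝ be open intervals, let f₁, f₂ : I₁ → ℝ and f₃ : I₂ → ℝ be smooth nowhere-zero functions, and set h₁ := f₁'/f₁, h₂ := f₂'/f₂, h₃ := f₃'/f₃. Then the system { h₁(x¹)h₂(x¹) + h₂'(x¹) − h₂(x¹)² = 0 for all x¹ ∈ I₁, h₃'(x²) = h₃(x²)² for all x² ∈ I₂, h₂(x¹)h₃(x²) = 0 for all x¹ ∈ I₁ and x² ∈ I₂ } holds if and only if one of the following holds, where F is any fixed antiderivative of 1/f₁ on I₁: (1) f₂ and f₃ are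 both constant; (2) f₂ is constant and f₃(x²) = k₃/(x² − c₃) with k₃ ∈ ℝ \ {0}, c₃ ∈ ℝ \ I₂; (3) f₃ is constant and f₂ = k₂/(F − c₂) with k₂ ∈ ℝ \ {0} and c₂ ∈ ℝ \ F(I₁). -/
/-- A function with vanishing derivative on an open interval is constant there. -/
lemma exists_eq_const_of_hasDerivAt_zero {I : Set ℝ} (hI : IsOpen I) (hc : I.OrdConnected)
    {u : ℝ → ℝ} (hu : ∀ x ∈ I, HasDerivAt u 0 x) : ∃ k, ∀ x ∈ I, u x = k :=
  hI.exists_is_const_of_deriv_eq_zero hc.isPreconnected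
    (fun x hx => (hu x hx).differentiableAt.differentiableWithinAt)
    (fun x hx => (hu x hx).deriv)

lemma ContDiffOn.hasDerivAt_of_isOpen {I : Set ℝ} (hI : IsOpen I) {f : ℝ → ℝ}
    (hf : ContDiffOn ℝ (⊤ : ℕ∞) f I) {x : ℝ} (hx : x ∈ I) : HasDerivAt f (deriv f x) x :=
  ((hf.differentiableOn (by simp)).differentiableAt (hI.mem_nhds hx)).hasDerivAt

/-- The flatness expression is, up to the factor `f / g`, the derivative of `f g' / g²`. -/
lemma hasDerivAt_mul_logDeriv_div {I : Set ℝ} (hI : IsOpen I) {f g : ℝ → ℝ}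
    (hf : ContDiffOn ℝ (⊤ : ℕ∞) f I) (hf0 : ∀ x ∈ I, f x ≠ 0)
    (hg : ContDiffOn ℝ (⊤ : ℕ∞) g I) (hg0 : ∀ x ∈ I, g x ≠ 0) {x : ℝ} (hx : x ∈ I) :
    HasDerivAt (fun x => f x * (deriv g x / g x) / g x)
      (f x / g x * (deriv f x / f x * (deriv g x / g x)
        + deriv (fun x => deriv g x / g x) x - (deriv g x / g x) ^ 2)) x := by
  have hf' := hf.hasDerivAt_of_isOpen hI hx
  have hg' := hg.hasDerivAt_of_isOpen hI hx
  have hdg : ContDiffOn ℝ (⊤ : ℕ∞) (deriv g) I := hg.deriv_of_isOpen hI (by simp)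
  have hh := (hdg.div hg hg0).hasDerivAt_of_isOpen hI hx
  have h1 := hf0 x hx
  have h2 := hg0 x hx
  refine ((hf'.fun_mul hh).fun_div hg' h2).congr_deriv ?_
  simp only [Pi.div_def]
  generalize deriv (fun x => deriv g x / g x) x = H
  field_simp

/-- Linearization: the equation holds iff `1 / g` is an affine function of an antiderivative
of `1 / f`. -/
lemma flatness_iff_inv_affine {I : Set ℝ} (hI : IsOpen I) (hc : I.OrdConnected) {f g F : ℝ → ℝ}
    (hf : ContDiffOn ℝ (⊤ : ℕ∞) f I) (hf0 : ∀ x ∈ I, f x ≠ 0)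
    (hg : ContDiffOn ℝ (⊤ : ℕ∞) g I) (hg0 : ∀ x ∈ I, g x ≠ 0)
    (hF : ∀ x ∈ I, HasDerivAt F (1 / f x) x) :
    (∀ x ∈ I, deriv f x / f x * (deriv g x / g x)
        + deriv (fun x => deriv g x / g x) x - (deriv g x / g x) ^ 2 = 0) ↔
      ∃ c d : ℝ, ∀ x ∈ I, (g x)⁻¹ = c * F x + d := by
  constructor
  · intro h
    obtain ⟨k, hk⟩ := exists_eq_const_of_hasDerivAt_zero hI hc
      (fun x hx => (hasDerivAt_mul_logDeriv_div hI hf hf0 hg hg0 hx).congr_deriv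
        (by rw [h x hx, mul_zero]))
    obtain ⟨d, hd⟩ := exists_eq_const_of_hasDerivAt_zero hI hc
      (u := fun x => (g x)⁻¹ + k * F x) (fun x hx => by
        refine (((hg.hasDerivAt_of_isOpen hI hx).fun_inv (hg0 x hx)).fun_add
          ((hF x hx).const_mul k)).congr_deriv ?_
        have h1 := hf0 x hx
        have h2 := hg0 x hx
        rw [← hk x hx]
        field_simp
        ring)
    exact ⟨-k, d, fun x hx => by linarith [hd x hx]⟩
  · rintro ⟨c, d, h⟩ x hx
    have hw : ∀ y ∈ I, f y * (deriv g y / g y) / g y = -c := fun y hy => by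
      have h1 := hf0 y hy
      have h2 := hg0 y hy
      have e := ((hg.hasDerivAt_of_isOpen hI hy).fun_inv h2).unique
        ((((hF y hy).const_mul c).add_const d).congr_of_eventuallyEq
          (Filter.eventuallyEq_of_mem (hI.mem_nhds hy) h))
      field_simp at e ⊢
      linarith
    have e := (hasDerivAt_mul_logDeriv_div hI hf hf0 hg hg0 hx).unique
      ((hasDerivAt_const x (-c)).congr_of_eventuallyEq
        (Filter.eventuallyEq_of_mem (hI.mem_nhds hx) hw))
    exact (mul_eq_zero.mp e).resolve_left (div_ne_zero (hf0 x hx) (hg0 x hx))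

lemma inv_affine_iff {I : Set ℝ} {g F : ℝ → ℝ} (hg0 : ∀ x ∈ I, g x ≠ 0) :
    (∃ c d : ℝ, ∀ x ∈ I, (g x)⁻¹ = c * F x + d) ↔
      (∃ k : ℝ, ∀ x ∈ I, g x = k) ∨
      ∃ k : ℝ, k ≠ 0 ∧ ∃ c : ℝ, (∀ x ∈ I, F x ≠ c) ∧ ∀ x ∈ I, g x = k / (F x - c) := by
  constructor
  · rintro ⟨c, d, h⟩
    by_cases hc : c = 0
    · exact .inl ⟨d⁻¹, fun x hx => by rw [← inv_inv (g x), h x hx, hc, zero_mul, zero_add]⟩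
    · have key : ∀ x ∈ I, (g x)⁻¹ = c * (F x - -d / c) := fun x hx => by
        rw [h x hx]; field_simp; ring
      refine .inr ⟨c⁻¹, inv_ne_zero hc, -d / c, fun x hx hFx => ?_, fun x hx => ?_⟩
      · exact inv_ne_zero (hg0 x hx) (by rw [key x hx, hFx, sub_self, mul_zero])
      · rw [← inv_inv (g x), key x hx, mul_inv, ← div_eq_mul_inv]
  · rintro (⟨k, h⟩ | ⟨k, hk, c, -, h⟩)
    · exact ⟨0, k⁻¹, fun x hx => by rw [h x hx, zero_mul, zero_add]⟩
    · exact ⟨k⁻¹, -k⁻¹ * c, fun x hx => by rw [h x hx, inv_div]; field_simp; ring⟩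

lemma logDeriv_eq_zero_iff_const {I : Set ℝ} (hI : IsOpen I) (hc : I.OrdConnected) {g : ℝ → ℝ}
    (hg : ContDiffOn ℝ (⊤ : ℕ∞) g I) (hg0 : ∀ x ∈ I, g x ≠ 0) :
    (∀ x ∈ I, deriv g x / g x = 0) ↔ ∃ k : ℝ, ∀ x ∈ I, g x = k := by
  constructor
  · intro h
    exact exists_eq_const_of_hasDerivAt_zero hI hc fun x hx =>
      (hg.hasDerivAt_of_isOpen hI hx).congr_deriv
        ((div_eq_zero_iff.mp (h x hx)).resolve_right (hg0 x hx))
  · rintro ⟨k, h⟩ x hx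
    rw [((hasDerivAt_const x k).congr_of_eventuallyEq
      (Filter.eventuallyEq_of_mem (hI.mem_nhds hx) h)).deriv, zero_div]

/-- Theorem 2.6 of the paper, in analytic form: for smooth nowhere-zero `f₁, f₂ : I₁ → ℝ` and
`f₃ : I₂ → ℝ` with `hᵢ = fᵢ'/fᵢ`, the flatness system holds iff `f₂, f₃` are both constant,
or `f₂` is constant and `f₃ = k₃/(x² - c₃)` with `c₃ ∉ I₂`, or `f₃` is constant and
`f₂ = k₂/(F - c₂)` where `F` is an antiderivative of `1/f₁` on `I₁`. -/
theorem stmt_7 (I₁ I₂ : Set ℝ)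
    (hI₁open : IsOpen I₁) (hI₁conn : I₁.OrdConnected) (hI₁ne : I₁.Nonempty)
    (hI₂open : IsOpen I₂) (hI₂conn : I₂.OrdConnected) (hI₂ne : I₂.Nonempty)
    (f₁ f₂ f₃ : ℝ → ℝ)
    (hf₁smooth : ContDiffOn ℝ (⊤ : ℕ∞) f₁ I₁) (hf₁ne : ∀ x ∈ I₁, f₁ x ≠ 0)
    (hf₂smooth : ContDiffOn ℝ (⊤ : ℕ∞) f₂ I₁) (hf₂ne : ∀ x ∈ I₁, f₂ x ≠ 0)
    (hf₃smooth : ContDiffOn ℝ (⊤ : ℕ∞) f₃ I₂) (hf₃ne : ∀ x ∈ I₂, f₃ x ≠ 0)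
    (h₁ h₂ h₃ : ℝ → ℝ)
    (hh₁ : h₁ = fun x => deriv f₁ x / f₁ x)
    (hh₂ : h₂ = fun x => deriv f₂ x / f₂ x)
    (hh₃ : h₃ = fun x => deriv f₃ x / f₃ x)
    (F : ℝ → ℝ) (hF : ∀ x ∈ I₁, HasDerivAt F (1 / f₁ x) x) :
    ((∀ x ∈ I₁, h₁ x * h₂ x + deriv h₂ x - (h₂ x) ^ 2 = 0) ∧
      (∀ y ∈ I₂, deriv h₃ y = (h₃ y) ^ 2) ∧
      (∀ x ∈ I₁, ∀ y ∈ I₂, h₂ x * h₃ y = 0)) ↔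
      ((∃ k₂ : ℝ, ∀ x ∈ I₁, f₂ x = k₂) ∧ (∃ k₃ : ℝ, ∀ y ∈ I₂, f₃ y = k₃)) ∨
      ((∃ k₂ : ℝ, ∀ x ∈ I₁, f₂ x = k₂) ∧
        ∃ k₃ : ℝ, k₃ ≠ 0 ∧ ∃ c₃ : ℝ, c₃ ∉ I₂ ∧ ∀ y ∈ I₂, f₃ y = k₃ / (y - c₃)) ∨
      ((∃ k₃ : ℝ, ∀ y ∈ I₂, f₃ y = k₃) ∧
        ∃ k₂ : ℝ, k₂ ≠ 0 ∧ ∃ c₂ : ℝ, (∀ x ∈ I₁, F x ≠ c₂) ∧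
          ∀ x ∈ I₁, f₂ x = k₂ / (F x - c₂)) := by
  have e₂ := (flatness_iff_inv_affine hI₁open hI₁conn hf₁smooth hf₁ne hf₂smooth hf₂ne hF).trans
    (inv_affine_iff hf₂ne)
  have e₃ := (flatness_iff_inv_affine (f := fun _ => 1) (F := id) hI₂open hI₂conn
    contDiffOn_const (by simp) hf₃smooth hf₃ne
    (fun x _ => (hasDerivAt_id x).congr_deriv (by simp))).trans (inv_affine_iff hf₃ne)
  have hprod : (∀ x ∈ I₁, ∀ y ∈ I₂, deriv f₂ x / f₂ x * (deriv f₃ y / f₃ y) = 0) ↔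
      (∃ k, ∀ x ∈ I₁, f₂ x = k) ∨ ∃ k, ∀ y ∈ I₂, f₃ y = k := by
    rw [← logDeriv_eq_zero_iff_const hI₁open hI₁conn hf₂smooth hf₂ne,
      ← logDeriv_eq_zero_iff_const hI₂open hI₂conn hf₃smooth hf₃ne]
    constructor
    · intro h
      by_contra! hne
      obtain ⟨⟨x, hx, hx0⟩, y, hy, hy0⟩ := hne
      exact mul_ne_zero hx0 hy0 (h x hx y hy)
    · rintro (h | h) x hx y hy
      · rw [h x hx, zero_mul]
      · rw [h y hy, mul_zero]
  have hmem (c : ℝ) : (∀ y ∈ I₂, y ≠ c) ↔ c ∉ I₂ :=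
    ⟨fun h hc => h c hc rfl, fun h y hy hyc => h (hyc ▸ hy)⟩
  simp only [deriv_const, zero_div, zero_mul, zero_add, sub_eq_zero, id, hmem] at e₃
  subst hh₁ hh₂ hh₃
  rw [e₂, e₃, hprod]
  constructor
  · rintro ⟨h2, h3, h | h⟩
    · exact h3.elim (fun h3 => .inl ⟨h, h3⟩) fun h3 => .inr (.inl ⟨h, h3⟩)
    · exact h2.elim (fun h2 => .inl ⟨h2, h⟩) fun h2 => .inr (.inr ⟨h, h2⟩)
  · rintro (⟨h2, h3⟩ | ⟨h2, h3⟩ | ⟨h3, h2⟩)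
    exacts [⟨.inl h2, .inl h3, .inl h2⟩, ⟨.inl h2, .inr h3, .inl h2⟩, ⟨.inr h2, .inl h3, .inr h3⟩]
end

section
/- Let I₁, I₂ ⊆ ℝ be open intervals and let f₁ : I₂ → ℝ and f₂ : I₁ → ℝ be smooth nowhere-zero functions. Then the equation f₁(x²)²·[(f₂'/f₂)' − (f₂'/f₂)²](x¹) + f₂(x¹)²·[(f₁'/f₁)' − (f₁'/f₁)²](x²) = 0 holds for all (x¹, x²) ∈ I₁ × I₂ if and only if there exists k ∈ ℝ such that f₁(x²)f₁''(x²) − 2(f₁'(x²))² = k·f₁(x²)⁴ for all x² ∈ I₂ and f₂(x¹)f₂''(x¹) − 2(f₂'(x¹))² = −k·f₂(x¹)⁴ for all x¹ ∈ I₁. -/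
/-- The quotient rule gives `(f'/f)' - (f'/f)² = (f f'' - 2 f'²) / f²` on an open set where `f` is
smooth and has no zeros. -/
theorem deriv_logDeriv_sub_sq {s : Set ℝ} (hs : IsOpen s) {f : ℝ → ℝ}
    (hf : ContDiffOn ℝ 2 f s) {x : ℝ} (hx : x ∈ s) (hfx : f x ≠ 0) :
    deriv (fun y => deriv f y / f y) x - (deriv f x / f x) ^ 2 =
      (f x * deriv (deriv f) x - 2 * deriv f x ^ 2) / f x ^ 2 := by
  have hf' : DifferentiableAt ℝ f x :=
    (hf.differentiableOn (by norm_num)).differentiableAt (hs.mem_nhds hx)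
  have hf'' : DifferentiableAt ℝ (deriv f) x :=
    ((hf.deriv_of_isOpen hs (m := 1) (by norm_num)).differentiableOn
      (by norm_num)).differentiableAt (hs.mem_nhds hx)
  rw [deriv_fun_div hf'' hf' hfx]
  field_simp
  ring


/-- Separation-of-variables equivalence at the core of Theorem 2.9 of the paper: for smooth
nowhere-zero `f₁ : I₂ → ℝ` and `f₂ : I₁ → ℝ`, the PDE
`f₁(x²)²[(f₂'/f₂)' - (f₂'/f₂)²](x¹) + f₂(x¹)²[(f₁'/f₁)' - (f₁'/f₁)²](x²) = 0` on `I₁ × I₂`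
holds iff there is a constant `k` with `f₁f₁'' - 2(f₁')² = k f₁⁴` on `I₂` and
`f₂f₂'' - 2(f₂')² = -k f₂⁴` on `I₁`. -/
theorem stmt_9 (I₁ I₂ : Set ℝ)
    (hI₁open : IsOpen I₁) (hI₁conn : I₁.OrdConnected) (hI₁ne : I₁.Nonempty)
    (hI₂open : IsOpen I₂) (hI₂conn : I₂.OrdConnected) (hI₂ne : I₂.Nonempty)
    (f₁ f₂ : ℝ → ℝ)
    (hf₁smooth : ContDiffOn ℝ (⊤ : ℕ∞) f₁ I₂) (hf₁ne : ∀ x ∈ I₂, f₁ x ≠ 0)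
    (hf₂smooth : ContDiffOn ℝ (⊤ : ℕ∞) f₂ I₁) (hf₂ne : ∀ x ∈ I₁, f₂ x ≠ 0)
    (h₁ h₂ : ℝ → ℝ)
    (hh₁ : h₁ = fun x => deriv f₁ x / f₁ x)
    (hh₂ : h₂ = fun x => deriv f₂ x / f₂ x) :
    (∀ x1 ∈ I₁, ∀ x2 ∈ I₂,
        (f₁ x2) ^ 2 * (deriv h₂ x1 - (h₂ x1) ^ 2) +
          (f₂ x1) ^ 2 * (deriv h₁ x2 - (h₁ x2) ^ 2) = 0) ↔
      ∃ k : ℝ,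
        (∀ x2 ∈ I₂,
          f₁ x2 * deriv (deriv f₁) x2 - 2 * (deriv f₁ x2) ^ 2 = k * (f₁ x2) ^ 4) ∧
        (∀ x1 ∈ I₁,
          f₂ x1 * deriv (deriv f₂) x1 - 2 * (deriv f₂ x1) ^ 2 = -k * (f₂ x1) ^ 4) := by
  have key₁ := fun x hx =>
    deriv_logDeriv_sub_sq hI₂open (contDiffOn_infty.1 hf₁smooth 2) hx (hf₁ne x hx)
  have key₂ := fun x hx =>
    deriv_logDeriv_sub_sq hI₁open (contDiffOn_infty.1 hf₂smooth 2) hx (hf₂ne x hx)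
  set u₁ := fun x => f₁ x * deriv (deriv f₁) x - 2 * deriv f₁ x ^ 2
  set u₂ := fun x => f₂ x * deriv (deriv f₂) x - 2 * deriv f₂ x ^ 2
  have pde_iff : ∀ x1 ∈ I₁, ∀ x2 ∈ I₂,
      ((f₁ x2) ^ 2 * (deriv h₂ x1 - (h₂ x1) ^ 2) +
          (f₂ x1) ^ 2 * (deriv h₁ x2 - (h₁ x2) ^ 2) = 0 ↔
        f₁ x2 ^ 4 * u₂ x1 + f₂ x1 ^ 4 * u₁ x2 = 0) := by
    intro x1 hx1 x2 hx2
    have n₁ := hf₁ne x2 hx2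
    have n₂ := hf₂ne x1 hx1
    rw [hh₁, hh₂, key₁ x2 hx2, key₂ x1 hx1]
    have clear_denom : f₁ x2 ^ 4 * u₂ x1 + f₂ x1 ^ 4 * u₁ x2 = f₁ x2 ^ 2 * f₂ x1 ^ 2 *
        (f₁ x2 ^ 2 * (u₂ x1 / f₂ x1 ^ 2) + f₂ x1 ^ 2 * (u₁ x2 / f₁ x2 ^ 2)) := by
      field_simp
    rw [clear_denom, mul_eq_zero_iff_left (by positivity)]
  constructor
  · intro h
    obtain ⟨a, ha⟩ := hI₁ne
    obtain ⟨b, hb⟩ := hI₂ne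
    have na := hf₂ne a ha
    have nb := hf₁ne b hb
    have h' := fun x1 hx1 x2 hx2 => (pde_iff x1 hx1 x2 hx2).1 (h x1 hx1 x2 hx2)
    have on_I₂ : ∀ x2 ∈ I₂, u₁ x2 = -u₂ a / f₂ a ^ 4 * f₁ x2 ^ 4 := by
      intro x2 hx2
      field_simp
      linear_combination h' a ha x2 hx2
    refine ⟨-u₂ a / f₂ a ^ 4, on_I₂, fun x1 hx1 => ?_⟩
    refine mul_left_cancel₀ (pow_ne_zero 4 nb) ?_
    linear_combination h' x1 hx1 b hb - f₂ x1 ^ 4 * on_I₂ b hb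
  · rintro ⟨k, on_I₂, on_I₁⟩ x1 hx1 x2 hx2
    rw [pde_iff x1 hx1 x2 hx2]
    linear_combination f₁ x2 ^ 4 * on_I₁ x1 hx1 + f₂ x1 ^ 4 * on_I₂ x2 hx2
end

section
/- Let I ⊆ ℝ be an open interval, let k ∈ ℝ \ {0}, and let g : I → ℝ be smooth with g(x)·g''(x) = −k and g'(x) ≠ 0 for all x ∈ I. Then there exist ε ∈ {−1, 1} and r ∈ ℝ such that for all x ∈ I one has −2k·ln|g(x)| + r > 0 and g'(x) = ε·√(−2k·ln|g(x)| + r). -/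
/-- The energy `(g')² + 2k·ln|g|` of a solution of `g·g'' = -k` has zero derivative. -/
lemma hasDerivAt_energy_of_mul_deriv_deriv {k x : ℝ} {g : ℝ → ℝ} (hk : k ≠ 0)
    (hg : DifferentiableAt ℝ g x) (hg' : DifferentiableAt ℝ (deriv g) x)
    (hode : g x * deriv (deriv g) x = -k) :
    HasDerivAt (fun y ↦ deriv g y ^ 2 + 2 * k * Real.log (g y)) 0 x := by
  have hgx : g x ≠ 0 := by
    intro h
    exact hk (by simpa [h] using hode)
  refine ((hg'.hasDerivAt.pow 2).add ((hg.hasDerivAt.log hgx).const_mul (2 * k))).congr_deriv ?_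
  field_simp
  linear_combination 2 * deriv g x * hode

/-- Characterization of critical-point-free solutions of `g''g = -k` (from the proof of
Theorem 2.8 of the paper): if `g` is smooth on the open interval `I` with `g·g'' = -k`, `k ≠ 0`,
and `g' ≠ 0` everywhere on `I`, then there are `ε ∈ {-1, 1}` and `r ∈ ℝ` such that
`-2k·ln|g| + r > 0` and `g' = ε·√(-2k·ln|g| + r)` on `I`. -/
theorem stmt_11 (I : Set ℝ)
    (hIopen : IsOpen I) (hIconn : I.OrdConnected) (hIne : I.Nonempty)
    (k : ℝ) (hk : k ≠ 0)
    (g : ℝ → ℝ)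
    (hgsmooth : ContDiffOn ℝ (⊤ : ℕ∞) g I)
    (hode : ∀ x ∈ I, g x * deriv (deriv g) x = -k)
    (hg' : ∀ x ∈ I, deriv g x ≠ 0) :
    ∃ ε : ℝ, (ε = -1 ∨ ε = 1) ∧ ∃ r : ℝ, ∀ x ∈ I,
      0 < -2 * k * Real.log |g x| + r ∧
      deriv g x = ε * Real.sqrt (-2 * k * Real.log |g x| + r) := by
  have hpre : IsPreconnected I := hIconn.isPreconnected
  have hsmooth' : ContDiffOn ℝ 1 (deriv g) I := hgsmooth.deriv_of_isOpen hIopen (by norm_cast)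
  have hdiff' : DifferentiableOn ℝ (deriv g) I := hsmooth'.differentiableOn one_ne_zero
  have henergy : ∀ x ∈ I,
      HasDerivAt (fun y ↦ deriv g y ^ 2 + 2 * k * Real.log (g y)) 0 x := fun x hx ↦
    hasDerivAt_energy_of_mul_deriv_deriv hk
      ((hgsmooth.differentiableOn (by simp)).differentiableAt (hIopen.mem_nhds hx))
      (hdiff'.differentiableAt (hIopen.mem_nhds hx)) (hode x hx)
  obtain ⟨r, hr⟩ := hIopen.exists_is_const_of_deriv_eq_zero hpre
    (fun x hx ↦ (henergy x hx).differentiableAt.differentiableWithinAt)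
    (fun x hx ↦ (henergy x hx).deriv)
  have hsq : ∀ x ∈ I, -2 * k * Real.log |g x| + r = deriv g x ^ 2 := fun x hx ↦ by
    rw [Real.log_abs]
    linear_combination -hr x hx
  have hpos : ∀ x ∈ I, 0 < -2 * k * Real.log |g x| + r := fun x hx ↦ by
    rw [hsq x hx]
    exact sq_pos_of_ne_zero (hg' x hx)
  have hsign : Set.EqOn (deriv g) (fun x ↦ |deriv g x|) I ∨
      Set.EqOn (deriv g) (-fun x ↦ |deriv g x|) I :=
    hpre.eq_or_eq_neg_of_sq_eq hdiff'.continuousOn hdiff'.continuousOn.abs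
      (fun x _ ↦ by simp) (fun {x} hx ↦ abs_ne_zero.mpr (hg' x hx))
  rcases hsign with h | h
  · refine ⟨1, Or.inr rfl, r, fun x hx ↦ ⟨hpos x hx, ?_⟩⟩
    rw [hsq x hx, Real.sqrt_sq_eq_abs, one_mul]
    exact h hx
  · refine ⟨-1, Or.inl rfl, r, fun x hx ↦ ⟨hpos x hx, ?_⟩⟩
    rw [hsq x hx, Real.sqrt_sq_eq_abs, neg_one_mul]
    exact h hx
end

section
/- Let I₁, I₂ ⊆ ℝ be open intervals and let f : I₁ × I₂ → ℝ be smooth and nowhere zero. Then the system of PDEs { ∂₁((∂₁f)/f) = ((∂₁f)/f)², ∂₂((∂₂f)/f) = ((∂₂f)/f)², ∂₁((∂₂f)/f) = ((∂₁f)/f)·((∂₂f)/f) on I₁ × I₂ } holds if and only if there exist c₁, c₂, c₃ ∈ ℝ such that c₁x¹ + c₂x² + c₃ ≠ 0 for all (x¹, x²) ∈ I₁ × I₂ and f(x¹, x²) = 1/(c₁x¹ + c₂x² + c₃) for all (x¹, x²) ∈ I₁ × I₂. -/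
open scoped Topology

/-- A function with constant derivative on an interval is affine there. -/
lemma eq_affine_of_hasDerivAt_const {I : Set ℝ} (hI : I.OrdConnected) (hIo : IsOpen I)
    {φ : ℝ → ℝ} {c : ℝ} (h : ∀ t ∈ I, HasDerivAt φ c t) {a b : ℝ} (ha : a ∈ I) (hb : b ∈ I) :
    φ b = φ a + c * (b - a) := by
  have hd : ∀ t ∈ I, HasDerivAt (fun t => φ t - c * t) 0 t := fun t ht =>
    ((h t ht).sub ((hasDerivAt_id t).const_mul c)).congr_deriv (by simp)
  have := hIo.is_const_of_deriv_eq_zero hI.isPreconnected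
    (fun t ht => (hd t ht).differentiableAt.differentiableWithinAt)
    (fun t ht => (hd t ht).deriv) ha hb
  linarith

lemma hasDerivAt_slice_fst {u : ℝ → ℝ → ℝ} {x y : ℝ}
    (h : DifferentiableAt ℝ (Function.uncurry u) (x, y)) :
    HasDerivAt (fun t => u t y) (fderiv ℝ (Function.uncurry u) (x, y) (1, 0)) x :=
  HasFDerivAt.comp_hasDerivAt x (f := fun t => (t, y)) h.hasFDerivAt ((hasDerivAt_id x).prodMk (hasDerivAt_const x y))

lemma hasDerivAt_slice_snd {u : ℝ → ℝ → ℝ} {x y : ℝ}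
    (h : DifferentiableAt ℝ (Function.uncurry u) (x, y)) :
    HasDerivAt (fun t => u x t) (fderiv ℝ (Function.uncurry u) (x, y) (0, 1)) y :=
  HasFDerivAt.comp_hasDerivAt y (f := fun t => (x, t)) h.hasFDerivAt ((hasDerivAt_const y x).prodMk (hasDerivAt_id y))

/-- The logarithmic directional derivative of a smooth nowhere zero function is differentiable. -/
lemma differentiableOn_fderiv_apply_div {U : Set (ℝ × ℝ)} (hU : IsOpen U) {F : ℝ × ℝ → ℝ}
    (hF : ContDiffOn ℝ (⊤ : ℕ∞) F U) (hne : ∀ p ∈ U, F p ≠ 0) (v : ℝ × ℝ) :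
    DifferentiableOn ℝ (fun p => fderiv ℝ F p v / F p) U := by
  have h : ContDiffOn ℝ 1 (fderiv ℝ F) U := hF.fderiv_of_isOpen hU (by norm_cast)
  have hF' : DifferentiableOn ℝ F U := hF.differentiableOn (by simp)
  simp only [div_eq_mul_inv]
  exact ((h.differentiableOn (by simp)).clm_apply (differentiableOn_const v)).mul (hF'.fun_inv hne)

/-- If `φ' / φ = l` and `m' = l m`, then `m / φ` has zero derivative. -/
lemma hasDerivAt_div_zero {φ m : ℝ → ℝ} {d t : ℝ} (hφ : HasDerivAt φ d t) (h0 : φ t ≠ 0)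
    (hm : HasDerivAt m (d / φ t * m t) t) : HasDerivAt (fun s => m s / φ s) 0 t := by
  refine (hm.div hφ h0).congr_deriv ?_
  field_simp
  ring

lemma hasDerivAt_inv_of_logDeriv {φ : ℝ → ℝ} {d t : ℝ} (hφ : HasDerivAt φ d t) (h0 : φ t ≠ 0) :
    HasDerivAt (fun s => (φ s)⁻¹) (-(d / φ t / φ t)) t := by
  refine (hφ.fun_inv h0).congr_deriv ?_
  field_simp

/-- The derivative of `k / (a t + b)`. -/
lemma hasDerivAt_div_affine (k a b t : ℝ) (h : a * t + b ≠ 0) :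
    HasDerivAt (fun s => k / (a * s + b)) (-(k * a) / (a * t + b) ^ 2) t := by
  have h1 : HasDerivAt (fun s => a * s + b) a t := by
    simpa using ((hasDerivAt_id t).const_mul a).add_const b
  exact ((hasDerivAt_const t k).div h1 h).congr_deriv (by ring)

lemma deriv_eq_of_eqOn_div_affine {I : Set ℝ} (hI : IsOpen I) {φ : ℝ → ℝ} {k a b t : ℝ}
    (ht : t ∈ I) (hφ : ∀ s ∈ I, φ s = k / (a * s + b)) (h : a * t + b ≠ 0) :
    deriv φ t = -(k * a) / (a * t + b) ^ 2 := by
  have he : φ =ᶠ[𝓝 t] fun s => k / (a * s + b) := by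
    filter_upwards [hI.mem_nhds ht] with s hs using hφ s hs
  rw [he.deriv_eq, (hasDerivAt_div_affine k a b t h).deriv]


/-- Theorem 3.3 of the paper, in analytic form: a smooth nowhere-zero `f : I₁ × I₂ → ℝ`
satisfies `∂₁(∂₁f/f) = (∂₁f/f)²`, `∂₂(∂₂f/f) = (∂₂f/f)²`, `∂₁(∂₂f/f) = (∂₁f/f)(∂₂f/f)` iff
`f(x¹,x²) = 1/(c₁x¹ + c₂x² + c₃)` for constants with nowhere-vanishing denominator. -/
theorem stmt_14 (I₁ I₂ : Set ℝ)
    (hI₁open : IsOpen I₁) (hI₁conn : I₁.OrdConnected) (hI₁ne : I₁.Nonempty)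
    (hI₂open : IsOpen I₂) (hI₂conn : I₂.OrdConnected) (hI₂ne : I₂.Nonempty)
    (f : ℝ → ℝ → ℝ)
    (hfsmooth : ContDiffOn ℝ (⊤ : ℕ∞) (Function.uncurry f) (I₁ ×ˢ I₂))
    (hfne : ∀ x ∈ I₁, ∀ y ∈ I₂, f x y ≠ 0)
    (l₁ l₂ : ℝ → ℝ → ℝ)
    (hl₁ : l₁ = fun x y => deriv (fun t => f t y) x / f x y)
    (hl₂ : l₂ = fun x y => deriv (fun t => f x t) y / f x y) :
    (∀ x ∈ I₁, ∀ y ∈ I₂,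
        deriv (fun t => l₁ t y) x = (l₁ x y) ^ 2 ∧
        deriv (fun t => l₂ x t) y = (l₂ x y) ^ 2 ∧
        deriv (fun t => l₂ t y) x = l₁ x y * l₂ x y) ↔
      ∃ c₁ c₂ c₃ : ℝ,
        (∀ x ∈ I₁, ∀ y ∈ I₂, c₁ * x + c₂ * y + c₃ ≠ 0) ∧
        (∀ x ∈ I₁, ∀ y ∈ I₂, f x y = 1 / (c₁ * x + c₂ * y + c₃)) := by
  have hU : IsOpen (I₁ ×ˢ I₂) := hI₁open.prod hI₂open
  have hne : ∀ p ∈ I₁ ×ˢ I₂, Function.uncurry f p ≠ 0 := fun p hp => hfne _ hp.1 _ hp.2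
  have hdf : ∀ x ∈ I₁, ∀ y ∈ I₂, DifferentiableAt ℝ (Function.uncurry f) (x, y) :=
    fun x hx y hy => (hfsmooth.differentiableOn (by simp)).differentiableAt
      (hU.mem_nhds ⟨hx, hy⟩)
  have hf₁ : ∀ x ∈ I₁, ∀ y ∈ I₂, HasDerivAt (fun t => f t y) (l₁ x y * f x y) x := by
    intro x hx y hy
    simpa [hl₁, hfne x hx y hy] using
      (hasDerivAt_slice_fst (hdf x hx y hy)).differentiableAt.hasDerivAt
  have hf₂ : ∀ x ∈ I₁, ∀ y ∈ I₂, HasDerivAt (fun t => f x t) (l₂ x y * f x y) y := by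
    intro x hx y hy
    simpa [hl₂, hfne x hx y hy] using
      (hasDerivAt_slice_snd (hdf x hx y hy)).differentiableAt.hasDerivAt
  constructor
  · intro h
    have hdl₁ : ∀ x ∈ I₁, ∀ y ∈ I₂, DifferentiableAt ℝ (Function.uncurry l₁) (x, y) := by
      intro x hx y hy
      refine ((differentiableOn_fderiv_apply_div hU hfsmooth hne (1, 0)).congr ?_).differentiableAt
        (hU.mem_nhds ⟨hx, hy⟩)
      rintro ⟨a, b⟩ ⟨ha, hb⟩
      simp [hl₁, Function.uncurry, (hasDerivAt_slice_fst (hdf a ha b hb)).deriv]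
    have hdl₂ : ∀ x ∈ I₁, ∀ y ∈ I₂, DifferentiableAt ℝ (Function.uncurry l₂) (x, y) := by
      intro x hx y hy
      refine ((differentiableOn_fderiv_apply_div hU hfsmooth hne (0, 1)).congr ?_).differentiableAt
        (hU.mem_nhds ⟨hx, hy⟩)
      rintro ⟨a, b⟩ ⟨ha, hb⟩
      simp [hl₂, Function.uncurry, (hasDerivAt_slice_snd (hdf a ha b hb)).deriv]
    obtain ⟨x₀, hx₀⟩ := hI₁ne
    obtain ⟨y₀, hy₀⟩ := hI₂ne
    have hA : ∀ x ∈ I₁, l₁ x y₀ / f x y₀ = l₁ x₀ y₀ / f x₀ y₀ := by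
      intro x hx
      have := eq_affine_of_hasDerivAt_const hI₁conn hI₁open
        (φ := fun t => l₁ t y₀ / f t y₀) (c := 0) (fun t ht => by
          refine hasDerivAt_div_zero (hf₁ t ht y₀ hy₀) (hfne t ht y₀ hy₀) ?_
          refine (hasDerivAt_slice_fst (hdl₁ t ht y₀ hy₀)).differentiableAt.hasDerivAt.congr_deriv ?_
          rw [(h t ht y₀ hy₀).1, mul_div_cancel_right₀ _ (hfne t ht y₀ hy₀), sq]) hx₀ hx
      simpa using this
    have hB : ∀ x ∈ I₁, ∀ y ∈ I₂, l₂ x y / f x y = l₂ x₀ y₀ / f x₀ y₀ := by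
      intro x hx y hy
      have e₁ := eq_affine_of_hasDerivAt_const hI₁conn hI₁open
        (φ := fun t => l₂ t y / f t y) (c := 0) (fun t ht => by
          refine hasDerivAt_div_zero (hf₁ t ht y hy) (hfne t ht y hy) ?_
          refine (hasDerivAt_slice_fst (hdl₂ t ht y hy)).differentiableAt.hasDerivAt.congr_deriv ?_
          rw [(h t ht y hy).2.2, mul_div_cancel_right₀ _ (hfne t ht y hy)]) hx₀ hx
      have e₂ := eq_affine_of_hasDerivAt_const hI₂conn hI₂open
        (φ := fun t => l₂ x₀ t / f x₀ t) (c := 0) (fun t ht => by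
          refine hasDerivAt_div_zero (hf₂ x₀ hx₀ t ht) (hfne x₀ hx₀ t ht) ?_
          refine (hasDerivAt_slice_snd (hdl₂ x₀ hx₀ t ht)).differentiableAt.hasDerivAt.congr_deriv ?_
          rw [(h x₀ hx₀ t ht).2.1, mul_div_cancel_right₀ _ (hfne x₀ hx₀ t ht), sq]) hy₀ hy
      simp only [zero_mul, add_zero] at e₁ e₂
      rw [e₁, e₂]
    have hg : ∀ x ∈ I₁, ∀ y ∈ I₂, (f x y)⁻¹ = -(l₁ x₀ y₀ / f x₀ y₀) * x
        + -(l₂ x₀ y₀ / f x₀ y₀) * y + ((f x₀ y₀)⁻¹ + l₁ x₀ y₀ / f x₀ y₀ * x₀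
        + l₂ x₀ y₀ / f x₀ y₀ * y₀) := by
      intro x hx y hy
      have e₁ := eq_affine_of_hasDerivAt_const hI₁conn hI₁open
        (φ := fun t => (f t y₀)⁻¹) (c := -(l₁ x₀ y₀ / f x₀ y₀)) (fun t ht => by
          have := hasDerivAt_inv_of_logDeriv (hf₁ t ht y₀ hy₀) (hfne t ht y₀ hy₀)
          rwa [mul_div_cancel_right₀ _ (hfne t ht y₀ hy₀), hA t ht] at this) hx₀ hx
      have e₂ := eq_affine_of_hasDerivAt_const hI₂conn hI₂open
        (φ := fun t => (f x t)⁻¹) (c := -(l₂ x₀ y₀ / f x₀ y₀)) (fun t ht => by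
          have := hasDerivAt_inv_of_logDeriv (hf₂ x hx t ht) (hfne x hx t ht)
          rwa [mul_div_cancel_right₀ _ (hfne x hx t ht), hB x hx t ht] at this) hy₀ hy
      rw [e₂, e₁]
      ring
    exact ⟨_, _, _, fun x hx y hy => hg x hx y hy ▸ inv_ne_zero (hfne x hx y hy),
      fun x hx y hy => by rw [← hg x hx y hy, one_div, inv_inv]⟩
  · rintro ⟨c₁, c₂, c₃, hc, hf⟩
    have hl₁' : ∀ x ∈ I₁, ∀ y ∈ I₂, l₁ x y = -c₁ / (c₁ * x + c₂ * y + c₃) := by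
      intro x hx y hy
      have h0 := hc x hx y hy
      have := deriv_eq_of_eqOn_div_affine hI₁open (φ := fun t => f t y) (k := 1) (a := c₁)
        (b := c₂ * y + c₃) hx (fun s hs => by rw [hf s hs y hy, add_assoc])
        (by rwa [← add_assoc])
      rw [← add_assoc] at this
      simp only [hl₁, this, hf x hx y hy]
      field_simp
    have hl₂' : ∀ x ∈ I₁, ∀ y ∈ I₂, l₂ x y = -c₂ / (c₁ * x + c₂ * y + c₃) := by
      intro x hx y hy
      have h0 := hc x hx y hy
      have e : ∀ s, c₁ * x + c₂ * s + c₃ = c₂ * s + (c₁ * x + c₃) := fun s => by ring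
      have := deriv_eq_of_eqOn_div_affine hI₂open (φ := fun t => f x t) (k := 1) (a := c₂)
        (b := c₁ * x + c₃) hy (fun s hs => by rw [hf x hx s hs, e]) (by rwa [← e])
      rw [← e] at this
      simp only [hl₂, this, hf x hx y hy]
      field_simp
    intro x hx y hy
    have h0 := hc x hx y hy
    have e₁ : ∀ s, c₁ * s + c₂ * y + c₃ = c₁ * s + (c₂ * y + c₃) := fun s => by ring
    have e₂ : ∀ s, c₁ * x + c₂ * s + c₃ = c₂ * s + (c₁ * x + c₃) := fun s => by ring
    refine ⟨?_, ?_, ?_⟩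
    · rw [deriv_eq_of_eqOn_div_affine hI₁open (k := -c₁) (a := c₁) (b := c₂ * y + c₃) hx
        (fun s hs => by rw [hl₁' s hs y hy, e₁]) (by rwa [← e₁]), ← e₁, hl₁' x hx y hy]
      field_simp
    · rw [deriv_eq_of_eqOn_div_affine hI₂open (k := -c₂) (a := c₂) (b := c₁ * x + c₃) hy
        (fun s hs => by rw [hl₂' x hx s hs, e₂]) (by rwa [← e₂]), ← e₂, hl₂' x hx y hy]
      field_simp
    · rw [deriv_eq_of_eqOn_div_affine hI₁open (k := -c₂) (a := c₁) (b := c₂ * y + c₃) hx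
        (fun s hs => by rw [hl₂' s hs y hy, e₁]) (by rwa [← e₁]), ← e₁, hl₁' x hx y hy,
        hl₂' x hx y hy]
      field_simp
end

section
/- Let f : ℝ² → ℝ be smooth and nowhere zero and suppose f satisfies the system of PDEs ∂₁((∂₁f)/f) = ((∂₁f)/f)², ∂₂((∂₂f)/f) = ((∂₂f)/f)², and ∂₁((∂₂f)/f) = ((∂₁f)/f)·((∂₂f)/f) on all of ℝ². Then f is constant. -/
/-- If the logarithmic derivative `u = g'/g` of a nowhere-zero `C²` function on `ℝ` satisfies
`u' = u²`, then `1/g` is affine without zeros, so `g` is constant. -/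
theorem eq_of_deriv_logDeriv_eq_sq {g : ℝ → ℝ} (hg : ContDiff ℝ 2 g) (hne : ∀ t, g t ≠ 0)
    (h : ∀ t, deriv (fun s => deriv g s / g s) t = (deriv g t / g t) ^ 2) (a b : ℝ) :
    g a = g b := by
  have hdiff : Differentiable ℝ g := hg.differentiable (by norm_num)
  have hdiff' : Differentiable ℝ (deriv g) :=
    (hg.iterate_deriv' 1 1).differentiable (by norm_num)
  have hinv (t : ℝ) : HasDerivAt (fun s => (g s)⁻¹) (-(deriv g t / g t * (g t)⁻¹)) t := by
    refine ((hdiff t).hasDerivAt.inv (hne t)).congr_deriv ?_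
    have := hne t
    field_simp
  have hlog (t : ℝ) : HasDerivAt (fun s => deriv g s / g s) ((deriv g t / g t) ^ 2) t := by
    rw [← h t]
    exact ((hdiff' t).div (hdiff t) (hne t)).hasDerivAt
  have hslope (t : ℝ) : HasDerivAt (fun s => deriv g s / g s * (g s)⁻¹) 0 t := by
    refine ((hlog t).mul (hinv t)).congr_deriv ?_
    ring
  obtain ⟨c, hc⟩ : ∃ c, ∀ t, deriv g t / g t * (g t)⁻¹ = c :=
    ⟨_, fun t => is_const_of_deriv_eq_zero (fun s => (hslope s).differentiableAt)
      (fun s => (hslope s).deriv) t 0⟩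
  have hsum (t : ℝ) : HasDerivAt (fun s => (g s)⁻¹ + c * s) 0 t := by
    refine ((hinv t).add ((hasDerivAt_id t).const_mul c)).congr_deriv ?_
    rw [hc]
    ring
  have haffine (s t : ℝ) : (g s)⁻¹ + c * s = (g t)⁻¹ + c * t :=
    is_const_of_deriv_eq_zero (fun r => (hsum r).differentiableAt) (fun r => (hsum r).deriv) s t
  have hc0 : c = 0 := by
    by_contra hc0
    have hzero := haffine ((g 0)⁻¹ / c) 0
    rw [mul_div_cancel₀ _ hc0] at hzero
    exact inv_ne_zero (hne ((g 0)⁻¹ / c)) (by linarith)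
  simpa [hc0] using haffine a b

/-- Corollary 3.5 of the paper, in analytic form: a smooth nowhere-zero `f : ℝ² → ℝ` that
satisfies the flatness PDE system `∂₁(∂₁f/f) = (∂₁f/f)²`, `∂₂(∂₂f/f) = (∂₂f/f)²`,
`∂₁(∂₂f/f) = (∂₁f/f)(∂₂f/f)` on all of `ℝ²` is constant. -/
theorem stmt_15 (f : ℝ → ℝ → ℝ)
    (hfsmooth : ContDiff ℝ (⊤ : ℕ∞) (Function.uncurry f))
    (hfne : ∀ x y : ℝ, f x y ≠ 0)
    (l₁ l₂ : ℝ → ℝ → ℝ)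
    (hl₁ : l₁ = fun x y => deriv (fun t => f t y) x / f x y)
    (hl₂ : l₂ = fun x y => deriv (fun t => f x t) y / f x y)
    (hsys : ∀ x y : ℝ,
        deriv (fun t => l₁ t y) x = (l₁ x y) ^ 2 ∧
        deriv (fun t => l₂ x t) y = (l₂ x y) ^ 2 ∧
        deriv (fun t => l₂ t y) x = l₁ x y * l₂ x y) :
    ∃ k : ℝ, ∀ x y : ℝ, f x y = k := by
  subst hl₁ hl₂
  have hf : ContDiff ℝ 2 (Function.uncurry f) := contDiff_infty.mp hfsmooth 2
  have hfst (y : ℝ) : ContDiff ℝ 2 (fun t => f t y) :=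
    hf.comp (contDiff_id.prodMk contDiff_const)
  have hsnd (x : ℝ) : ContDiff ℝ 2 (fun t => f x t) :=
    hf.comp (contDiff_const.prodMk contDiff_id)
  refine ⟨f 0 0, fun x y => ?_⟩
  calc f x y = f 0 y :=
        eq_of_deriv_logDeriv_eq_sq (hfst y) (fun t => hfne t y) (fun t => (hsys t y).1) x 0
    _ = f 0 0 :=
        eq_of_deriv_logDeriv_eq_sq (hsnd 0) (hfne 0) (fun t => (hsys 0 t).2.1) y 0
end

section
/- Let I₁ ⊆ ℝ be an open interval, let f₂, f₃ : I₁ → ℝ be smooth nowhere-zero functions, and set h₂ := f₂'/f₂, h₃ := f₃'/f₃. Then the system { h₂'(x) = h₂(x)², h₃'(x) = h₃(x)², h₂(x)h₃(x) = 0 for all x ∈ I₁ } holds if and only if one of the following holds: (1) f₂ and f₃ are both constant; (2) f₂ is constant and f₃(x) = k₃/(x − c₃) with k₃ ∈ ℝ \ {0}, c₃ ∈ ℝ \ I₁; (3) f₃ is constant and f₂(x) = k₂/(x − c₂) with k₂ ∈ ℝ \ {0}, c₂ ∈ ℝ \ I₁. In particular, f₂ and f₃ cannot both be nonconstant. -/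
section LogDerivRiccati

variable {s : Set ℝ} {f : ℝ → ℝ}

lemma deriv_div_self_eq_zero_of_eqOn_const (hs : IsOpen s) {k : ℝ} (hf : ∀ x ∈ s, f x = k)
    {x : ℝ} (hx : x ∈ s) : deriv f x / f x = 0 := by
  have h : f =ᶠ[nhds x] fun _ => k := Filter.eventually_of_mem (hs.mem_nhds hx) hf
  simp [h.deriv_eq]

lemma deriv_div_self_of_eqOn_div_sub (hs : IsOpen s) {k c : ℝ} (hk : k ≠ 0) (hc : c ∉ s)
    (hf : ∀ x ∈ s, f x = k / (x - c)) {x : ℝ} (hx : x ∈ s) :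
    deriv f x / f x = -(x - c)⁻¹ := by
  have h : f =ᶠ[nhds x] fun y => k / (y - c) := Filter.eventually_of_mem (hs.mem_nhds hx) hf
  have hxc : x - c ≠ 0 := sub_ne_zero.2 fun e => hc (e ▸ hx)
  have hd : HasDerivAt (fun y => k / (y - c)) _ x :=
    (hasDerivAt_const x k).div ((hasDerivAt_id x).sub_const c) hxc
  rw [h.deriv_eq, hd.deriv, hf x hx]
  field_simp
  ring

lemma deriv_logDeriv_eq_sq_of_eqOn_const (hs : IsOpen s) {k : ℝ} (hf : ∀ x ∈ s, f x = k)
    {x : ℝ} (hx : x ∈ s) :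
    deriv (fun y => deriv f y / f y) x = (deriv f x / f x) ^ 2 := by
  have h : (fun y => deriv f y / f y) =ᶠ[nhds x] fun _ => (0 : ℝ) :=
    Filter.eventually_of_mem (hs.mem_nhds hx)
      fun _ hy => deriv_div_self_eq_zero_of_eqOn_const hs hf hy
  rw [h.deriv_eq, deriv_div_self_eq_zero_of_eqOn_const hs hf hx]
  simp

lemma deriv_logDeriv_eq_sq_of_eqOn_div_sub (hs : IsOpen s) {k c : ℝ} (hk : k ≠ 0)
    (hc : c ∉ s) (hf : ∀ x ∈ s, f x = k / (x - c)) {x : ℝ} (hx : x ∈ s) :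
    deriv (fun y => deriv f y / f y) x = (deriv f x / f x) ^ 2 := by
  have h : (fun y => deriv f y / f y) =ᶠ[nhds x] fun y => -(y - c)⁻¹ :=
    Filter.eventually_of_mem (hs.mem_nhds hx)
      fun _ hy => deriv_div_self_of_eqOn_div_sub hs hk hc hf hy
  have hxc : x - c ≠ 0 := sub_ne_zero.2 fun e => hc (e ▸ hx)
  have hd : HasDerivAt (fun y => -(y - c)⁻¹) _ x :=
    (((hasDerivAt_id x).sub_const c).inv hxc).neg
  rw [h.deriv_eq, hd.deriv, deriv_div_self_of_eqOn_div_sub hs hk hc hf hx]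
  simp only [id]
  field_simp

/-- If the logarithmic derivative of `f` solves `h' = h²` on an open interval, then `1 / f` is
affine there. -/
lemma eqOn_const_or_eqOn_div_sub_of_deriv_logDeriv_eq_sq (hs : IsOpen s) (hs' : s.OrdConnected)
    (hf : ContDiffOn ℝ 2 f s) (hf0 : ∀ x ∈ s, f x ≠ 0)
    (h : ∀ x ∈ s, deriv (fun y => deriv f y / f y) x = (deriv f x / f x) ^ 2) :
    (∃ k : ℝ, ∀ x ∈ s, f x = k) ∨
      ∃ k : ℝ, k ≠ 0 ∧ ∃ c : ℝ, c ∉ s ∧ ∀ x ∈ s, f x = k / (x - c) := by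
  have hpc : IsPreconnected s := hs'.isPreconnected
  have hd : ∀ x ∈ s, HasDerivAt f (deriv f x) x := fun x hx =>
    ((hf.differentiableOn (by norm_num)).differentiableAt (hs.mem_nhds hx)).hasDerivAt
  have hd2 : ∀ x ∈ s, DifferentiableAt ℝ (deriv f) x := fun x hx =>
    ((hf.deriv_of_isOpen (m := 1) hs (by norm_num)).differentiableOn
      (by norm_num)).differentiableAt (hs.mem_nhds hx)
  have hh : ∀ x ∈ s, HasDerivAt (fun y => deriv f y / f y) ((deriv f x / f x) ^ 2) x :=
    fun x hx => h x hx ▸ ((hd2 x hx).div (hd x hx).differentiableAt (hf0 x hx)).hasDerivAt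
  have hu' : ∀ x ∈ s, HasDerivAt (fun y => deriv f y / f y / f y) 0 x := fun x hx => by
    have hx0 := hf0 x hx
    refine ((hh x hx).div (hd x hx) hx0).congr_deriv ?_
    field_simp
    ring
  obtain ⟨a, ha⟩ := hs.exists_is_const_of_deriv_eq_zero hpc
    (fun x hx => (hu' x hx).differentiableAt.differentiableWithinAt)
    (fun x hx => (hu' x hx).deriv)
  have hv : ∀ x ∈ s, HasDerivAt (fun y => (f y)⁻¹ + a * y) 0 x := fun x hx => by
    have hx0 := hf0 x hx
    refine (((hd x hx).inv hx0).add ((hasDerivAt_id x).const_mul a)).congr_deriv ?_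
    rw [← ha x hx]
    field_simp
    ring
  obtain ⟨b, hb⟩ := hs.exists_is_const_of_deriv_eq_zero hpc
    (fun x hx => (hv x hx).differentiableAt.differentiableWithinAt)
    (fun x hx => (hv x hx).deriv)
  have hfx : ∀ x ∈ s, f x = (b - a * x)⁻¹ := fun x hx => by
    rw [← hb x hx]
    simp
  rcases eq_or_ne a 0 with rfl | ha0
  · exact Or.inl ⟨b⁻¹, fun x hx => by simp [hfx x hx]⟩
  · refine Or.inr ⟨-a⁻¹, by simpa using ha0, b / a, fun hc => hf0 _ hc ?_, fun x hx => ?_⟩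
    · rw [hfx _ hc, mul_div_cancel₀ _ ha0, sub_self, inv_zero]
    · rw [hfx x hx, show b - a * x = -a * (x - b / a) by field_simp; ring, mul_inv, inv_neg]
      rfl

end LogDerivRiccati

/-- Theorem 3.6 / Corollary 3.7 of the paper, in analytic form: for smooth nowhere-zero
`f₂, f₃ : I₁ → ℝ` with `hᵢ = fᵢ'/fᵢ`, the system `h₂' = h₂²`, `h₃' = h₃²`, `h₂h₃ = 0` holds iff
both are constant, or one of them is constant and the other equals `k/(x - c)` with `c ∉ I₁`.
In particular, `f₂` and `f₃` cannot both be nonconstant. -/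
theorem stmt_16 (I₁ : Set ℝ)
    (hI₁open : IsOpen I₁) (hI₁conn : I₁.OrdConnected) (hI₁ne : I₁.Nonempty)
    (f₂ f₃ : ℝ → ℝ)
    (hf₂smooth : ContDiffOn ℝ (⊤ : ℕ∞) f₂ I₁) (hf₂ne : ∀ x ∈ I₁, f₂ x ≠ 0)
    (hf₃smooth : ContDiffOn ℝ (⊤ : ℕ∞) f₃ I₁) (hf₃ne : ∀ x ∈ I₁, f₃ x ≠ 0)
    (h₂ h₃ : ℝ → ℝ)
    (hh₂ : h₂ = fun x => deriv f₂ x / f₂ x)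
    (hh₃ : h₃ = fun x => deriv f₃ x / f₃ x) :
    ((∀ x ∈ I₁, deriv h₂ x = (h₂ x) ^ 2 ∧ deriv h₃ x = (h₃ x) ^ 2 ∧
        h₂ x * h₃ x = 0) ↔
      ((∃ k₂ : ℝ, ∀ x ∈ I₁, f₂ x = k₂) ∧ (∃ k₃ : ℝ, ∀ x ∈ I₁, f₃ x = k₃)) ∨
      ((∃ k₂ : ℝ, ∀ x ∈ I₁, f₂ x = k₂) ∧
        ∃ k₃ : ℝ, k₃ ≠ 0 ∧ ∃ c₃ : ℝ, c₃ ∉ I₁ ∧ ∀ x ∈ I₁, f₃ x = k₃ / (x - c₃)) ∨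
      ((∃ k₃ : ℝ, ∀ x ∈ I₁, f₃ x = k₃) ∧
        ∃ k₂ : ℝ, k₂ ≠ 0 ∧ ∃ c₂ : ℝ, c₂ ∉ I₁ ∧ ∀ x ∈ I₁, f₂ x = k₂ / (x - c₂))) ∧
    ((∀ x ∈ I₁, deriv h₂ x = (h₂ x) ^ 2 ∧ deriv h₃ x = (h₃ x) ^ 2 ∧
        h₂ x * h₃ x = 0) →
      (∃ k₂ : ℝ, ∀ x ∈ I₁, f₂ x = k₂) ∨ (∃ k₃ : ℝ, ∀ x ∈ I₁, f₃ x = k₃)) := by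
  subst hh₂ hh₃
  have key : (∀ x ∈ I₁, deriv (fun x => deriv f₂ x / f₂ x) x = (deriv f₂ x / f₂ x) ^ 2 ∧
      deriv (fun x => deriv f₃ x / f₃ x) x = (deriv f₃ x / f₃ x) ^ 2 ∧
        deriv f₂ x / f₂ x * (deriv f₃ x / f₃ x) = 0) ↔
      ((∃ k₂ : ℝ, ∀ x ∈ I₁, f₂ x = k₂) ∧ (∃ k₃ : ℝ, ∀ x ∈ I₁, f₃ x = k₃)) ∨
      ((∃ k₂ : ℝ, ∀ x ∈ I₁, f₂ x = k₂) ∧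
        ∃ k₃ : ℝ, k₃ ≠ 0 ∧ ∃ c₃ : ℝ, c₃ ∉ I₁ ∧ ∀ x ∈ I₁, f₃ x = k₃ / (x - c₃)) ∨
      ((∃ k₃ : ℝ, ∀ x ∈ I₁, f₃ x = k₃) ∧
        ∃ k₂ : ℝ, k₂ ≠ 0 ∧ ∃ c₂ : ℝ, c₂ ∉ I₁ ∧ ∀ x ∈ I₁, f₂ x = k₂ / (x - c₂)) := by
    constructor
    · intro h
      rcases eqOn_const_or_eqOn_div_sub_of_deriv_logDeriv_eq_sq hI₁open hI₁conn
        (hf₂smooth.of_le (WithTop.coe_le_coe.2 le_top)) hf₂ne fun x hx => (h x hx).1 with c₂ | r₂ <;>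
      rcases eqOn_const_or_eqOn_div_sub_of_deriv_logDeriv_eq_sq hI₁open hI₁conn
        (hf₃smooth.of_le (WithTop.coe_le_coe.2 le_top)) hf₃ne fun x hx => (h x hx).2.1 with c₃ | r₃
      · exact Or.inl ⟨c₂, c₃⟩
      · exact Or.inr (Or.inl ⟨c₂, r₃⟩)
      · exact Or.inr (Or.inr ⟨c₃, r₂⟩)
      · obtain ⟨k₂, hk₂, c₂, hc₂, e₂⟩ := r₂
        obtain ⟨k₃, hk₃, c₃, hc₃, e₃⟩ := r₃
        obtain ⟨x, hx⟩ := hI₁ne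
        have h0 := (h x hx).2.2
        rw [deriv_div_self_of_eqOn_div_sub hI₁open hk₂ hc₂ e₂ hx,
          deriv_div_self_of_eqOn_div_sub hI₁open hk₃ hc₃ e₃ hx] at h0
        have n₂ : x - c₂ ≠ 0 := sub_ne_zero.2 fun e => hc₂ (e ▸ hx)
        have n₃ : x - c₃ ≠ 0 := sub_ne_zero.2 fun e => hc₃ (e ▸ hx)
        simp [n₂, n₃] at h0
    · rintro (⟨⟨k₂, e₂⟩, k₃, e₃⟩ | ⟨⟨k₂, e₂⟩, k₃, hk₃, c₃, hc₃, e₃⟩ |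
        ⟨⟨k₃, e₃⟩, k₂, hk₂, c₂, hc₂, e₂⟩) x hx
      · exact ⟨deriv_logDeriv_eq_sq_of_eqOn_const hI₁open e₂ hx,
          deriv_logDeriv_eq_sq_of_eqOn_const hI₁open e₃ hx,
          by rw [deriv_div_self_eq_zero_of_eqOn_const hI₁open e₂ hx, zero_mul]⟩
      · exact ⟨deriv_logDeriv_eq_sq_of_eqOn_const hI₁open e₂ hx,
          deriv_logDeriv_eq_sq_of_eqOn_div_sub hI₁open hk₃ hc₃ e₃ hx,
          by rw [deriv_div_self_eq_zero_of_eqOn_const hI₁open e₂ hx, zero_mul]⟩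
      · exact ⟨deriv_logDeriv_eq_sq_of_eqOn_div_sub hI₁open hk₂ hc₂ e₂ hx,
          deriv_logDeriv_eq_sq_of_eqOn_const hI₁open e₃ hx,
          by rw [deriv_div_self_eq_zero_of_eqOn_const hI₁open e₃ hx, mul_zero]⟩
  refine ⟨key, fun h => ?_⟩
  rcases key.1 h with h | h | h
  · exact Or.inl h.1
  · exact Or.inl h.1
  · exact Or.inr h.1
end
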